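/- Let φ : ℂ → ℝ be a nonnegative subharmonic C²-function such that Δφ dλ is a nontrivial doubling measure on ℂ. Then the complex vector space of C² functions g : ℂ → ℂ satisfying ∫_ℂ |g|² dλ < ∞ and (−Δ_A − V) g = 0 pointwise is infinite-dimensional; here Δ_A g = (−∂/∂x − (i/2) ∂φ/∂y)² g + (−∂/∂y + (i/2) ∂φ/∂x)² g and V = ½ Δφ. In particular the Pauli operator P₋ = −Δ_A − V has an infinite-dimensional space of zero modes in L²(ℝ²). -/

import Mathlib

open MeasureTheory

/-- Partial derivative `∂u/∂x` of `u : ℂ → ℂ` (identifying `ℂ ≅ ℝ²`, `z = x + iy`). -/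
noncomputable def pdx (u : ℂ → ℂ) (z : ℂ) : ℂ := fderiv ℝ u z 1

/-- Partial derivative `∂u/∂y` of `u : ℂ → ℂ`. -/
noncomputable def pdy (u : ℂ → ℂ) (z : ℂ) : ℂ := fderiv ℝ u z Complex.I

/-- Partial derivative `∂φ/∂x` of `φ : ℂ → ℝ`. -/
noncomputable def pdxR (φ : ℂ → ℝ) (z : ℂ) : ℝ := fderiv ℝ φ z 1

/-- Partial derivative `∂φ/∂y` of `φ : ℂ → ℝ`. -/
noncomputable def pdyR (φ : ℂ → ℝ) (z : ℂ) : ℝ := fderiv ℝ φ z Complex.I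

/-- The Laplacian `Δφ = ∂²φ/∂x² + ∂²φ/∂y²` of `φ : ℂ → ℝ`. -/
noncomputable def lap (φ : ℂ → ℝ) (z : ℂ) : ℝ :=
  pdxR (fun w => pdxR φ w) z + pdyR (fun w => pdyR φ w) z

/-- The operator `(-∂/∂x - (i/2) ∂φ/∂y)` appearing in the magnetic Laplacian. -/
noncomputable def opD1 (φ : ℂ → ℝ) (v : ℂ → ℂ) : ℂ → ℂ :=
  fun z => -(pdx v z) - (Complex.I / 2) * (pdyR φ z : ℂ) * v z

/-- The operator `(-∂/∂y + (i/2) ∂φ/∂x)` appearing in the magnetic Laplacian. -/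
noncomputable def opD2 (φ : ℂ → ℝ) (v : ℂ → ℂ) : ℂ → ℂ :=
  fun z => -(pdy v z) + (Complex.I / 2) * (pdxR φ z : ℂ) * v z

/-- The magnetic Laplacian `Δ_A = (-∂/∂x - (i/2)∂φ/∂y)² + (-∂/∂y + (i/2)∂φ/∂x)²`. -/
noncomputable def lapA (φ : ℂ → ℝ) (g : ℂ → ℂ) (z : ℂ) : ℂ :=
  opD1 φ (opD1 φ g) z + opD2 φ (opD2 φ g) z

section Weyl
open Set Metric
open scoped Convolution Topology

/-- Mean value property of entire functions against a radial kernel. -/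
lemma integral_radial_mul_entire {G : ℂ → ℂ} (hG : Differentiable ℂ G) {k : ℝ → ℝ}
    (hk : Continuous k) {R : ℝ} (hkR : ∀ r, R ≤ r → k r = 0) (z : ℂ) :
    ∫ w, k ‖w‖ • G (z + w) = (∫ w : ℂ, k ‖w‖) • G z := by
  have hcont : Continuous G := hG.continuous
  have key : ∀ H : ℂ → ℂ, Continuous H →
      ∫ w, k ‖w‖ • H w =
        ∫ r in Ioi (0 : ℝ), ∫ θ in Ioo (-Real.pi) Real.pi,
          r • k r • H (r * (Real.cos θ + Real.sin θ * Complex.I)) := by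
    intro H hH
    rw [← Complex.integral_comp_polarCoord_symm, polarCoord_target]
    have hInt : IntegrableOn (fun p : ℝ × ℝ =>
        p.1 • k p.1 • H (p.1 * (Real.cos p.2 + Real.sin p.2 * Complex.I)))
        (Ioi (0 : ℝ) ×ˢ Ioo (-Real.pi) Real.pi) (volume.prod volume) := by
      have hc : Continuous (fun p : ℝ × ℝ =>
        p.1 • k p.1 • H (p.1 * (Real.cos p.2 + Real.sin p.2 * Complex.I))) := by fun_prop
      have h1 : IntegrableOn (fun p : ℝ × ℝ =>
        p.1 • k p.1 • H (p.1 * (Real.cos p.2 + Real.sin p.2 * Complex.I)))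
          (Icc (0 : ℝ) R ×ˢ Icc (-Real.pi) Real.pi) (volume.prod volume) :=
        hc.continuousOn.integrableOn_compact (isCompact_Icc.prod isCompact_Icc)
      refine h1.of_forall_sdiff_eq_zero (measurableSet_Ioi.prod measurableSet_Ioo) ?_
      rintro ⟨r, θ⟩ ⟨⟨hr, hθ⟩, hn⟩
      have : R ≤ r := by
        by_contra hlt
        exact hn ⟨⟨le_of_lt hr, le_of_not_ge hlt⟩, ⟨hθ.1.le, hθ.2.le⟩⟩
      simp [hkR r this]
    rw [← setIntegral_prod _ hInt]
    refine setIntegral_congr_fun (measurableSet_Ioi.prod measurableSet_Ioo) ?_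
    rintro ⟨r, θ⟩ ⟨hr, hθ⟩
    have hr' : |r| = r := abs_of_pos hr
    have hn := Complex.norm_polarCoord_symm (r, θ)
    simp only [hr', Complex.polarCoord_symm_apply] at hn
    simp only [Complex.polarCoord_symm_apply, hn]
  rw [key (fun w => G (z + w)) (by fun_prop), ← integral_smul_const,
    key (fun _ => G z) (by fun_prop)]
  refine setIntegral_congr_fun measurableSet_Ioi fun r _ => ?_
  have hmv := (hG.diffContOnCl (s := ball z |r|)).circleAverage
  rw [Real.circleAverage_def] at hmv
  have hper : ∫ θ in Ioo (-Real.pi) Real.pi, G (z + r * (Real.cos θ + Real.sin θ * Complex.I))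
      = ∫ θ in (0 : ℝ)..2 * Real.pi, G (circleMap z r θ) := by
    have hcm : ∀ θ : ℝ, G (z + r * (Real.cos θ + Real.sin θ * Complex.I)) = G (circleMap z r θ) := by
      intro θ
      simp [circleMap, Complex.exp_mul_I]
    simp_rw [hcm]
    rw [← integral_Ioc_eq_integral_Ioo, ← intervalIntegral.integral_of_le (by linarith [Real.pi_pos])]
    have hp : Function.Periodic (fun θ => G (circleMap z r θ)) (2 * Real.pi) := fun θ => by
      simp [periodic_circleMap z r θ]
    have := hp.intervalIntegral_add_eq (-Real.pi) 0
    rw [zero_add, show -Real.pi + 2 * Real.pi = Real.pi by ring] at this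
    exact this
  simp only [integral_smul, hper]
  rw [← hmv]
  simp only [integral_const, smul_smul]
  congr 1
  have : (2 * Real.pi) ≠ 0 := by positivity
  have hvol : (volume.restrict (Ioo (-Real.pi) Real.pi)).real univ = 2 * Real.pi := by
    simp [Real.pi_pos.le]
    ring
  rw [hvol]
  field_simp

/-- The convolution of a weakly holomorphic function with a test function is entire. -/
lemma differentiable_convolution_of_weakly_holomorphic {F : ℂ → ℂ} (hF : LocallyIntegrable F)
    (hw : ∀ ω : ℂ → ℝ, ContDiff ℝ 2 ω → HasCompactSupport ω →
      ∫ z, ((pdxR ω z : ℂ) + Complex.I * (pdyR ω z : ℂ)) * F z = 0)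
    {k : ℂ → ℝ} (hk : ContDiff ℝ 2 k) (hkc : HasCompactSupport k) :
    Differentiable ℂ (k ⋆[ContinuousLinearMap.lsmul ℝ ℝ, volume] F) := by
  intro x
  have hder := hkc.hasFDerivAt_convolution_left (ContinuousLinearMap.lsmul ℝ ℝ)
    (hk.of_le one_le_two) hF x
  have hex : ConvolutionExistsAt (fderiv ℝ k) F x
      ((ContinuousLinearMap.lsmul ℝ ℝ : ℝ →L[ℝ] ℂ →L[ℝ] ℂ).precompL ℂ) volume :=
    (hkc.fderiv ℝ).convolutionExists_left _ (hk.continuous_fderiv two_ne_zero) hF x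
  have hval : ∀ v : ℂ, ((fderiv ℝ k ⋆[(ContinuousLinearMap.lsmul ℝ ℝ).precompL ℂ, volume] F) x) v
      = ∫ t, (fderiv ℝ k (x - t) v : ℂ) * F t := by
    intro v
    rw [convolution_def, ContinuousLinearMap.integral_apply hex]
    rw [← integral_sub_left_eq_self _ volume x]
    simp
  rw [differentiableAt_complex_iff_differentiableAt_real]
  refine ⟨hder.differentiableAt, ?_⟩
  rw [hder.fderiv, hval, hval]
  have hωc : HasCompactSupport (fun t => k (x - t)) :=
    hkc.comp_homeomorph (Homeomorph.subLeft x)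
  have hω : ContDiff ℝ 2 (fun t => k (x - t)) := hk.comp (contDiff_const.sub contDiff_id)
  have hdω : ∀ t v, fderiv ℝ (fun t => k (x - t)) t v = - fderiv ℝ k (x - t) v := by
    intro t v
    have h1 := ((hk.differentiable two_ne_zero).differentiableAt (x := x - t)).hasFDerivAt.comp t
      ((hasFDerivAt_id (𝕜 := ℝ) t).const_sub x)
    have h2 : fderiv ℝ (fun t => k (x - t)) t = _ := h1.fderiv
    rw [h2]; simp
  have h0 := hw _ hω hωc
  have hInt : ∀ v : ℂ, Integrable (fun t => (fderiv ℝ k (x - t) v : ℂ) * F t) := by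
    intro v
    have hc : Continuous (fun t => (fderiv ℝ k (x - t) v : ℂ)) := by
      have := hk.continuous_fderiv two_ne_zero
      fun_prop
    have hs : HasCompactSupport (fun t => (fderiv ℝ k (x - t) v : ℂ)) := by
      have := ((hkc.fderiv ℝ).comp_homeomorph (Homeomorph.subLeft x))
      exact this.comp_left (g := fun L : ℂ →L[ℝ] ℝ => ((L v : ℝ) : ℂ)) (by simp)
    simpa using hF.integrable_smul_left_of_hasCompactSupport hc hs
  have e : ∀ t, ((pdxR (fun t => k (x - t)) t : ℂ) + Complex.I * (pdyR (fun t => k (x - t)) t : ℂ)) * F t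
      = -((fderiv ℝ k (x - t) 1 : ℂ) * F t) - Complex.I * ((fderiv ℝ k (x - t) Complex.I : ℂ) * F t) := by
    intro t
    simp only [pdxR, pdyR, hdω]; push_cast; ring
  simp_rw [e] at h0
  rw [integral_sub (hInt 1).fun_neg ((hInt Complex.I).const_mul _), integral_neg, integral_const_mul] at h0
  rw [smul_eq_mul]
  linear_combination Complex.I * h0 + (∫ t, (fderiv ℝ k (x - t) Complex.I : ℂ) * F t) * Complex.I_sq

/-- A smooth radial kernel of total mass one. -/
lemma exists_radial_kernel : ∃ k : ℝ → ℝ, Continuous k ∧ (∀ r, 2 ≤ r → k r = 0) ∧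
    ContDiff ℝ 2 (fun w : ℂ => k ‖w‖) ∧ HasCompactSupport (fun w : ℂ => k ‖w‖) ∧
    ∫ w : ℂ, k ‖w‖ = 1 := by
  set B := ContDiffBumpBase.ofInnerProductSpace ℂ
  set k₀ : ℝ → ℝ := fun r => Real.smoothTransition (2 - r) with hk₀
  have hBk : ∀ w, B.toFun 2 w = k₀ ‖w‖ := fun w => by
    simp only [B, ContDiffBumpBase.ofInnerProductSpace, hk₀]; norm_num
  have hc : Continuous k₀ := Real.smoothTransition.continuous.comp (by fun_prop)
  have hz : ∀ r, 2 ≤ r → k₀ r = 0 := fun r hr =>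
    Real.smoothTransition.zero_of_nonpos (by linarith)
  have hsm : ContDiff ℝ 2 (fun w : ℂ => k₀ ‖w‖) := by
    have : (fun w : ℂ => k₀ ‖w‖) = fun w => Function.uncurry B.toFun (2, w) := by
      funext w; simp [Function.uncurry, hBk]
    rw [this, contDiff_iff_contDiffAt]
    intro w
    have hB := (B.smooth.contDiffAt (x := ((2 : ℝ), w)) (by
      refine (isOpen_Ioi.prod isOpen_univ).mem_nhds ?_
      constructor <;> simp)).of_le (m := 2) (WithTop.coe_le_coe.2 le_top)
    exact hB.comp w (contDiffAt_const.prodMk contDiffAt_id)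
  have hcs : HasCompactSupport (fun w : ℂ => k₀ ‖w‖) := by
    refine HasCompactSupport.intro (isCompact_closedBall (0 : ℂ) 2) fun w hw => hz _ ?_
    simp at hw; exact hw.le
  have hpos : 0 < ∫ w : ℂ, k₀ ‖w‖ := by
    refine Continuous.integral_pos_of_hasCompactSupport_nonneg_nonzero (x := 0)
      hsm.continuous hcs (fun w => Real.smoothTransition.nonneg _) ?_
    simp [hk₀, Real.smoothTransition.one_of_one_le]
  refine ⟨fun r => (∫ w : ℂ, k₀ ‖w‖)⁻¹ * k₀ r, by fun_prop, fun r hr => by simp [hz r hr],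
    contDiff_const.mul hsm, hcs.mul_left, ?_⟩
  rw [integral_const_mul, inv_mul_cancel₀ hpos.ne']

/-- **Weyl's lemma** for the Cauchy–Riemann operator. -/
lemma exists_entire_ae_eq {F : ℂ → ℂ} (hF : LocallyIntegrable F)
    (hw : ∀ ω : ℂ → ℝ, ContDiff ℝ 2 ω → HasCompactSupport ω →
      ∫ z, ((pdxR ω z : ℂ) + Complex.I * (pdyR ω z : ℂ)) * F z = 0) :
    ∃ G : ℂ → ℂ, Differentiable ℂ G ∧ F =ᵐ[volume] G := by
  obtain ⟨k, hk, hkz, hksm, hkcs, hk1⟩ := exists_radial_kernel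
  set κ : ℂ → ℝ := fun w => k ‖w‖ with hκ
  refine ⟨κ ⋆[ContinuousLinearMap.lsmul ℝ ℝ, volume] F,
    differentiable_convolution_of_weakly_holomorphic hF hw hksm hkcs, ?_⟩
  have hG := differentiable_convolution_of_weakly_holomorphic hF hw hksm hkcs
  let b : ℕ → ContDiffBump (0 : ℂ) := fun n =>
    ⟨1 / ((n : ℝ) + 1), 2 * (1 / ((n : ℝ) + 1)), by positivity, by
      have : (0 : ℝ) < 1 / ((n : ℝ) + 1) := by positivity
      linarith⟩
  have hb : Filter.Tendsto (fun n => (b n).rOut) Filter.atTop (𝓝 0) := by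
    simpa [b] using (tendsto_one_div_add_atTop_nhds_zero_nat (𝕜 := ℝ)).const_mul 2
  have hae := ContDiffBump.ae_convolution_tendsto_right_of_locallyIntegrable (K := 2) hb
    (Filter.Eventually.of_forall fun n => le_refl _) hF
  have hreg : ∀ n x, ((b n).normed volume ⋆[ContinuousLinearMap.lsmul ℝ ℝ, volume] F) x
      = ((b n).normed volume ⋆[ContinuousLinearMap.lsmul ℝ ℝ, volume]
          (κ ⋆[ContinuousLinearMap.lsmul ℝ ℝ, volume] F)) x := by
    intro n x
    set β : ℂ → ℝ := (b n).normed volume with hβ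
    have hβsm : ContDiff ℝ 2 β := (b n).contDiff_normed
    have hβcs : HasCompactSupport β := (b n).hasCompactSupport_normed
    have hFn := differentiable_convolution_of_weakly_holomorphic hF hw hβsm hβcs
    have hmv := integral_radial_mul_entire hFn hk hkz x
    rw [hk1, one_smul] at hmv
    have hassoc : ∀ {f g : ℂ → ℝ}, Continuous f → HasCompactSupport f → Continuous g →
        HasCompactSupport g →
        ((f ⋆[ContinuousLinearMap.lsmul ℝ ℝ, volume] g) ⋆[ContinuousLinearMap.lsmul ℝ ℝ, volume] F) x
        = (f ⋆[ContinuousLinearMap.lsmul ℝ ℝ, volume]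
            (g ⋆[ContinuousLinearMap.lsmul ℝ ℝ, volume] F)) x := by
      intro f g hf hfc hg hgc
      have hFn : LocallyIntegrable (fun x => ‖F x‖) := fun x => (hF x).norm
      refine convolution_assoc _ _ _ _ (fun a b c => by simp [mul_smul])
        hf.aestronglyMeasurable hg.aestronglyMeasurable hF.aestronglyMeasurable ?_ ?_ ?_
      · exact Filter.Eventually.of_forall fun y =>
          hfc.convolutionExists_left _ hf hg.locallyIntegrable y
      · exact Filter.Eventually.of_forall fun y =>
          hgc.norm.convolutionExists_left _ hg.norm hFn y
      · refine hfc.norm.convolutionExists_left _ hf.norm ?_ x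
        exact (hgc.norm.continuous_convolution_left _ hg.norm hFn).locallyIntegrable
    rw [← hassoc hβsm.continuous hβcs hksm.continuous hkcs]
    have hcomm : (β ⋆[ContinuousLinearMap.lsmul ℝ ℝ, volume] κ)
        = (κ ⋆[ContinuousLinearMap.lsmul ℝ ℝ, volume] β) := by
      rw [← convolution_flip]
      congr 1
      ext; simp
    rw [hcomm, hassoc hksm.continuous hkcs hβsm.continuous hβcs, ← hmv, convolution_def]
    rw [← integral_neg_eq_self]
    refine integral_congr_ae (Filter.Eventually.of_forall fun w => ?_)
    simp [hκ, sub_eq_add_neg]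
  filter_upwards [hae] with x hx
  refine tendsto_nhds_unique hx ?_
  simp_rw [hreg]
  exact ContDiffBump.convolution_tendsto_right_of_continuous hb hG.continuous x

end Weyl

section Calculus
variable {E : Type*} [NormedAddCommGroup E] [NormedSpace ℝ E]

lemma ContDiff.fderiv_apply_const {f : ℂ → E} (hf : ContDiff ℝ 2 f) (v : ℂ) :
    ContDiff ℝ 1 (fun z => fderiv ℝ f z v) :=
  (hf.fderiv_right (m := 1) (by norm_num)).clm_apply contDiff_const

lemma fderiv_fderiv_apply_comm {f : ℂ → E} (hf : ContDiff ℝ 2 f) (z u v : ℂ) :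
    fderiv ℝ (fun w => fderiv ℝ f w u) z v = fderiv ℝ (fun w => fderiv ℝ f w v) z u := by
  have hd : DifferentiableAt ℝ (fderiv ℝ f) z :=
    ((hf.fderiv_right (m := 1) (by norm_num)).differentiable one_ne_zero).differentiableAt
  have key : ∀ a b : ℂ, fderiv ℝ (fun w => fderiv ℝ f w a) z b = fderiv ℝ (fderiv ℝ f) z b a := by
    intro a b
    rw [fderiv_clm_apply hd (by fun_prop)]
    simp
  rw [key, key]
  exact (hf.contDiffAt (x := z)).isSymmSndFDerivAt (by simp) v u

lemma DifferentiableAt.hasDerivAt_line {f : ℂ → E} {z : ℂ} (hf : DifferentiableAt ℝ f z) (v : ℂ) :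
    HasDerivAt (fun t : ℝ => f (z + t • v)) (fderiv ℝ f z v) 0 :=
  hf.hasFDerivAt.hasLineDerivAt v

lemma fderiv_apply_eq_of_hasDerivAt_line {f : ℂ → E} {z v : ℂ} {a : E}
    (hf : DifferentiableAt ℝ f z) (h : HasDerivAt (fun t : ℝ => f (z + t • v)) a 0) :
    fderiv ℝ f z v = a :=
  (hf.hasDerivAt_line v).unique h

lemma integral_fderiv_apply_eq_zero [CompleteSpace E] {G : ℂ → E} (hG : ContDiff ℝ 1 G)
    (hc : HasCompactSupport G) (v : ℂ) : ∫ z, fderiv ℝ G z v = 0 := by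
  have hi : Integrable (fun z => fderiv ℝ G z v) :=
    (hG.continuous_fderiv_apply one_ne_zero |>.comp
      (continuous_id.prodMk continuous_const)).integrable_of_hasCompactSupport
      ((hc.fderiv ℝ).comp_left (g := fun L : ℂ →L[ℝ] E => L v) (by simp))
  have := integral_smul_fderiv_eq_neg_fderiv_smul_of_integrable (μ := (volume : Measure ℂ)) (𝕜 := ℝ)
    (f := fun _ : ℂ => (1 : ℝ)) (g := G) (v := v) (by simp) (by simpa using hi)
    (by simpa using hG.continuous.integrable_of_hasCompactSupport hc) (by simp)
    (fun x _ => (hG.differentiable one_ne_zero).differentiableAt)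
  simpa using this

end Calculus

lemma ContDiff.continuous_lap {ψ : ℂ → ℝ} (hψ : ContDiff ℝ 2 ψ) : Continuous (lap ψ) :=
  ((hψ.fderiv_apply_const 1).continuous_fderiv_apply one_ne_zero |>.comp
    (continuous_id.prodMk continuous_const)).add
  ((hψ.fderiv_apply_const Complex.I).continuous_fderiv_apply one_ne_zero |>.comp
    (continuous_id.prodMk continuous_const))

section Pauli

lemma lapA_eq_of_dbar_eq {φ : ℂ → ℝ} (hφ : ContDiff ℝ 2 φ) {g : ℂ → ℂ} (hg : ContDiff ℝ 2 g)
    (h : ∀ z, pdx g z + Complex.I * pdy g z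
      = -(1 / 2) * ((pdxR φ z : ℂ) + Complex.I * (pdyR φ z : ℂ)) * g z) (z : ℂ) :
    lapA φ g z = -(((1 / 2) * lap φ z : ℝ) : ℂ) * g z := by
  have hI := Complex.I_sq
  have h12 : opD1 φ g = fun w => -Complex.I * opD2 φ g w := by
    funext w
    simp only [opD1, opD2]
    linear_combination -(h w) + (1 / 2 * (pdxR φ w : ℂ) * g w) * hI
  have h21 : opD2 φ g = fun w => Complex.I * opD1 φ g w := by
    funext w
    rw [h12]
    linear_combination (opD2 φ g w) * hI
  have hgd : ∀ v, DifferentiableAt ℝ (fun w => fderiv ℝ g w v) z := fun v =>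
    ((hg.fderiv_apply_const v).differentiable one_ne_zero).differentiableAt
  have hφd : ∀ v, DifferentiableAt ℝ (fun w => ((fderiv ℝ φ w v : ℝ) : ℂ)) z := fun v =>
    (Complex.ofRealCLM.differentiable.comp
      ((hφ.fderiv_apply_const v).differentiable one_ne_zero)).differentiableAt
  have hg0 : DifferentiableAt ℝ g z := (hg.differentiable two_ne_zero).differentiableAt
  have hφline : ∀ u v : ℂ, HasDerivAt (fun t : ℝ => ((fderiv ℝ φ (z + t • v) u : ℝ) : ℂ))
      ((fderiv ℝ (fun w => fderiv ℝ φ w u) z v : ℝ) : ℂ) 0 := fun u v =>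
    (((hφ.fderiv_apply_const u).differentiable
      one_ne_zero).differentiableAt.hasDerivAt_line v).ofReal_comp
  have e1 : fderiv ℝ (opD1 φ g) z Complex.I = -(fderiv ℝ (fun w => fderiv ℝ g w 1) z Complex.I)
      - Complex.I / 2 * ((fderiv ℝ (fun w => fderiv ℝ φ w Complex.I) z Complex.I : ℝ) : ℂ) * g z
      - Complex.I / 2 * (pdyR φ z : ℂ) * pdy g z := by
    refine fderiv_apply_eq_of_hasDerivAt_line ?_ ?_
    · exact (hgd 1).neg.sub (((hφd Complex.I).const_mul _).mul hg0)
    · have := ((hgd 1).hasDerivAt_line Complex.I).neg.sub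
        (((hφline Complex.I Complex.I).const_mul (Complex.I / 2)).mul (hg0.hasDerivAt_line Complex.I))
      refine this.congr_deriv ?_
      simp [pdyR, pdy]; ring
  have e2 : fderiv ℝ (opD2 φ g) z 1 = -(fderiv ℝ (fun w => fderiv ℝ g w Complex.I) z 1)
      + Complex.I / 2 * ((fderiv ℝ (fun w => fderiv ℝ φ w 1) z 1 : ℝ) : ℂ) * g z
      + Complex.I / 2 * (pdxR φ z : ℂ) * pdx g z := by
    refine fderiv_apply_eq_of_hasDerivAt_line ?_ ?_
    · exact (hgd Complex.I).neg.add (((hφd 1).const_mul _).mul hg0)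
    · have := ((hgd Complex.I).hasDerivAt_line 1).neg.add
        (((hφline 1 1).const_mul (Complex.I / 2)).mul (hg0.hasDerivAt_line 1))
      refine this.congr_deriv ?_
      simp [pdxR, pdx]; ring
  have hd1 : DifferentiableAt ℝ (opD1 φ g) z :=
    (hgd 1).neg.sub (((hφd Complex.I).const_mul _).mul hg0)
  have hd2 : DifferentiableAt ℝ (opD2 φ g) z :=
    (hgd Complex.I).neg.add (((hφd 1).const_mul _).mul hg0)
  have f1 : pdx (opD1 φ g) z = -Complex.I * fderiv ℝ (opD2 φ g) z 1 := by
    rw [pdx, h12, fderiv_const_mul hd2]; simp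
  have f2 : pdy (opD2 φ g) z = Complex.I * fderiv ℝ (opD1 φ g) z Complex.I := by
    rw [pdy, h21, fderiv_const_mul hd1]; simp
  have hs := fderiv_fderiv_apply_comm hg z 1 Complex.I
  have k1 := congrFun h12 z
  have k2 := congrFun h21 z
  have o1 : opD1 φ g z = -(pdx g z) - (Complex.I / 2) * (pdyR φ z : ℂ) * g z := rfl
  have o2 : opD2 φ g z = -(pdy g z) + (Complex.I / 2) * (pdxR φ z : ℂ) * g z := rfl
  rw [lapA]
  show -(pdx (opD1 φ g) z) - (Complex.I / 2) * (pdyR φ z : ℂ) * opD1 φ g z +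
    (-(pdy (opD2 φ g) z) + (Complex.I / 2) * (pdxR φ z : ℂ) * opD2 φ g z) = _
  rw [f1, f2, e1, e2, hs, k1]
  rw [k1] at o1
  simp only [lap, pdxR, pdyR, pdx, pdy] at *
  push_cast
  generalize opD2 φ g z = q at *
  generalize ((fderiv ℝ φ z 1 : ℝ) : ℂ) = a at *
  generalize ((fderiv ℝ φ z Complex.I : ℝ) : ℂ) = b at *
  generalize fderiv ℝ g z 1 = gx at *
  generalize fderiv ℝ g z Complex.I = gy at *
  linear_combination (1 / 2 * ((fderiv ℝ (fun w => fderiv ℝ φ w 1) z 1 : ℝ) : ℂ) * g z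
    + 1 / 2 * ((fderiv ℝ (fun w => fderiv ℝ φ w Complex.I) z Complex.I : ℝ) : ℂ) * g z
    + 1 / 2 * a * gx + 1 / 2 * b * q + 1 / 2 * b * gy) * hI - a / 2 * o1 - b / 2 * o2

/-- If `f` is entire, then `f * exp (-φ / 2)` is a zero mode of the Pauli operator `P₋`. -/
lemma pauli_zero_mode_of_entire {φ : ℂ → ℝ} (hφ : ContDiff ℝ 2 φ) {f : ℂ → ℂ}
    (hf : Differentiable ℂ f) :
    ContDiff ℝ 2 (fun z => (Real.exp (-φ z / 2) : ℂ) * f z) ∧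
    ∀ z, -(lapA φ (fun z => (Real.exp (-φ z / 2) : ℂ) * f z) z)
      - (((1 / 2) * lap φ z : ℝ) : ℂ) * ((Real.exp (-φ z / 2) : ℂ) * f z) = 0 := by
  have hf2 : ContDiff ℝ 2 f := (hf.contDiff (n := 2)).restrict_scalars ℝ
  have he2 : ContDiff ℝ 2 (fun z => ((Real.exp (-φ z / 2) : ℝ) : ℂ)) :=
    Complex.ofRealCLM.contDiff.comp (Real.contDiff_exp.comp (hφ.neg.div_const 2))
  have hg : ContDiff ℝ 2 (fun z => (Real.exp (-φ z / 2) : ℂ) * f z) := he2.mul hf2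
  refine ⟨hg, fun z => ?_⟩
  rw [lapA_eq_of_dbar_eq hφ hg]
  · ring
  intro w
  have hd : ∀ v : ℂ, fderiv ℝ (fun z => (Real.exp (-φ z / 2) : ℂ) * f z) w v
      = (Real.exp (-φ w / 2) : ℂ) * (-(1 / 2) * (fderiv ℝ φ w v : ℂ) * f w + fderiv ℝ f w v) := by
    intro v
    refine fderiv_apply_eq_of_hasDerivAt_line ((hg.differentiable two_ne_zero).differentiableAt) ?_
    have h1 := (((((hφ.differentiable two_ne_zero).differentiableAt (x := w)).hasDerivAt_line
      v).neg.div_const 2).exp).ofReal_comp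
    have h2 := ((hf2.differentiable two_ne_zero).differentiableAt (x := w)).hasDerivAt_line v
    refine (h1.mul h2).congr_deriv ?_
    simp
    ring
  have hCR := (differentiableAt_complex_iff_differentiableAt_real.1 (hf w)).2
  rw [smul_eq_mul] at hCR
  simp only [pdx, pdy, pdxR, pdyR, hd, hCR]
  linear_combination (Real.exp (-φ w / 2) : ℂ) * fderiv ℝ f w 1 * Complex.I_sq

end Pauli

section Carleman

/-- The weighted Carleman inequality for the Cauchy–Riemann operator, in real coordinates. -/
lemma integral_lap_mul_le_of_real {ψ p q : ℂ → ℝ} (hψ : ContDiff ℝ 2 ψ) (hp : ContDiff ℝ 2 p)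
    (hq : ContDiff ℝ 2 q) (hpc : HasCompactSupport p) (hqc : HasCompactSupport q) :
    ∫ z, lap ψ z * (p z ^ 2 + q z ^ 2) * Real.exp (ψ z) ≤
      ∫ z, ((pdxR p z - pdyR q z) ^ 2 + (pdxR q z + pdyR p z) ^ 2) * Real.exp (ψ z) := by
  set P : ℂ → ℝ := fun z => (-(pdxR ψ z * (p z ^ 2 + q z ^ 2))
    - 2 * (p z * pdyR q z - q z * pdyR p z)) * Real.exp (ψ z) with hP
  set Q : ℂ → ℝ := fun z => (-(pdyR ψ z * (p z ^ 2 + q z ^ 2))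
    + 2 * (p z * pdxR q z - q z * pdxR p z)) * Real.exp (ψ z) with hQ
  have c1 : ∀ {f : ℂ → ℝ}, ContDiff ℝ 2 f → ContDiff ℝ 1 f := fun h => h.of_le one_le_two
  have cx : ∀ {f : ℂ → ℝ}, ContDiff ℝ 2 f → ContDiff ℝ 1 (pdxR f) :=
    fun h => h.fderiv_apply_const 1
  have cy : ∀ {f : ℂ → ℝ}, ContDiff ℝ 2 f → ContDiff ℝ 1 (pdyR f) :=
    fun h => h.fderiv_apply_const Complex.I
  have hexp : ContDiff ℝ 1 (fun z => Real.exp (ψ z)) := Real.contDiff_exp.comp (c1 hψ)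
  have hPc1 : ContDiff ℝ 1 P :=
    (((cx hψ).mul (((c1 hp).pow 2).add ((c1 hq).pow 2))).neg.sub
      (contDiff_const.mul (((c1 hp).mul (cy hq)).sub ((c1 hq).mul (cy hp))))).mul hexp
  have hQc1 : ContDiff ℝ 1 Q :=
    (((cy hψ).mul (((c1 hp).pow 2).add ((c1 hq).pow 2))).neg.add
      (contDiff_const.mul (((c1 hp).mul (cx hq)).sub ((c1 hq).mul (cx hp))))).mul hexp
  set K : Set ℂ := tsupport p ∪ tsupport q with hK
  have hKc : IsCompact K := hpc.isCompact.union hqc.isCompact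
  have hpK : ∀ z ∉ K, p z = 0 := fun z hz =>
    image_eq_zero_of_notMem_tsupport fun h => hz (Or.inl h)
  have hqK : ∀ z ∉ K, q z = 0 := fun z hz =>
    image_eq_zero_of_notMem_tsupport fun h => hz (Or.inr h)
  have hdpK : ∀ z ∉ K, fderiv ℝ p z = 0 := fun z hz =>
    image_eq_zero_of_notMem_tsupport fun h => hz (Or.inl (tsupport_fderiv_subset ℝ h))
  have hdqK : ∀ z ∉ K, fderiv ℝ q z = 0 := fun z hz =>
    image_eq_zero_of_notMem_tsupport fun h => hz (Or.inr (tsupport_fderiv_subset ℝ h))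
  have hPcs : HasCompactSupport P := HasCompactSupport.intro hKc fun z hz => by
    simp [hP, hpK z hz, hqK z hz]
  have hQcs : HasCompactSupport Q := HasCompactSupport.intro hKc fun z hz => by
    simp [hQ, hpK z hz, hqK z hz]
  have hP0 := integral_fderiv_apply_eq_zero hPc1 hPcs 1
  have hQ0 := integral_fderiv_apply_eq_zero hQc1 hQcs Complex.I
  set A : ℂ → ℝ := fun z => ((pdxR p z - pdyR q z) ^ 2 + (pdxR q z + pdyR p z) ^ 2)
    * Real.exp (ψ z) with hA
  set L : ℂ → ℝ := fun z => lap ψ z * (p z ^ 2 + q z ^ 2) * Real.exp (ψ z) with hL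
  have hdP : ∀ z, fderiv ℝ P z 1 = (-(pdxR (pdxR ψ) z * (p z ^ 2 + q z ^ 2))
      - pdxR ψ z * (2 * p z * pdxR p z + 2 * q z * pdxR q z)
      - 2 * (pdxR p z * pdyR q z + p z * pdxR (pdyR q) z
        - pdxR q z * pdyR p z - q z * pdxR (pdyR p) z)) * Real.exp (ψ z)
      + (-(pdxR ψ z * (p z ^ 2 + q z ^ 2)) - 2 * (p z * pdyR q z - q z * pdyR p z))
        * (Real.exp (ψ z) * pdxR ψ z) := by
    intro z
    refine fderiv_apply_eq_of_hasDerivAt_line (hPc1.differentiable one_ne_zero).differentiableAt ?_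
    have hl : ∀ {f : ℂ → ℝ}, ContDiff ℝ 1 f →
        HasDerivAt (fun t : ℝ => f (z + t • 1)) (pdxR f z) 0 := fun h =>
      ((h.differentiable one_ne_zero).differentiableAt).hasDerivAt_line 1
    have := (((hl (cx hψ)).mul (((hl (c1 hp)).pow 2).add ((hl (c1 hq)).pow 2))).neg.sub
      ((((hl (c1 hp)).mul (hl (cy hq))).sub ((hl (c1 hq)).mul (hl (cy hp)))).const_mul 2)).mul
      (hl (c1 hψ)).exp
    refine this.congr_deriv ?_
    simp
    ring
  have hdQ : ∀ z, fderiv ℝ Q z Complex.I = (-(pdyR (pdyR ψ) z * (p z ^ 2 + q z ^ 2))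
      - pdyR ψ z * (2 * p z * pdyR p z + 2 * q z * pdyR q z)
      + 2 * (pdyR p z * pdxR q z + p z * pdyR (pdxR q) z
        - pdyR q z * pdxR p z - q z * pdyR (pdxR p) z)) * Real.exp (ψ z)
      + (-(pdyR ψ z * (p z ^ 2 + q z ^ 2)) + 2 * (p z * pdxR q z - q z * pdxR p z))
        * (Real.exp (ψ z) * pdyR ψ z) := by
    intro z
    refine fderiv_apply_eq_of_hasDerivAt_line (hQc1.differentiable one_ne_zero).differentiableAt ?_
    have hl : ∀ {f : ℂ → ℝ}, ContDiff ℝ 1 f →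
        HasDerivAt (fun t : ℝ => f (z + t • Complex.I)) (pdyR f z) 0 := fun h =>
      ((h.differentiable one_ne_zero).differentiableAt).hasDerivAt_line Complex.I
    have := (((hl (cy hψ)).mul (((hl (c1 hp)).pow 2).add ((hl (c1 hq)).pow 2))).neg.add
      ((((hl (c1 hp)).mul (hl (cx hq))).sub ((hl (c1 hq)).mul (hl (cx hp)))).const_mul 2)).mul
      (hl (c1 hψ)).exp
    refine this.congr_deriv ?_
    simp
    ring
  have hLi : Integrable L := by
    refine Continuous.integrable_of_hasCompactSupport ?_ (HasCompactSupport.intro hKc fun z hz => ?_)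
    · exact (hψ.continuous_lap.mul ((hp.continuous.pow 2).add (hq.continuous.pow 2))).mul hexp.continuous
    · simp [hL, hpK z hz, hqK z hz]
  have hAi : Integrable A := by
    refine Continuous.integrable_of_hasCompactSupport ?_ (HasCompactSupport.intro hKc fun z hz => ?_)
    · exact ((((cx hp).continuous.sub (cy hq).continuous).pow 2).add
        (((cx hq).continuous.add (cy hp).continuous).pow 2)).mul hexp.continuous
    · simp [hA, pdxR, pdyR, hdpK z hz, hdqK z hz]
  have hdi : ∀ {G : ℂ → ℝ}, ContDiff ℝ 1 G → HasCompactSupport G → ∀ v,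
      Integrable (fun z => fderiv ℝ G z v) := fun hG hc v =>
    (hG.continuous_fderiv_apply one_ne_zero |>.comp
      (continuous_id.prodMk continuous_const)).integrable_of_hasCompactSupport
      ((hc.fderiv ℝ).comp_left (g := fun L : ℂ →L[ℝ] ℝ => L v) (by simp))
  have hPi := hdi hPc1 hPcs 1
  have hQi := hdi hQc1 hQcs Complex.I
  have hpt : ∀ z, L z + (fderiv ℝ P z 1 + fderiv ℝ Q z Complex.I) ≤ A z := by
    intro z
    have hsp : pdyR (pdxR p) z = pdxR (pdyR p) z := fderiv_fderiv_apply_comm hp z 1 Complex.I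
    have hsq : pdyR (pdxR q) z = pdxR (pdyR q) z := fderiv_fderiv_apply_comm hq z 1 Complex.I
    have hB : 0 ≤ ((pdxR p z + pdyR q z + pdxR ψ z * p z + pdyR ψ z * q z) ^ 2
      + (pdxR q z - pdyR p z + pdxR ψ z * q z - pdyR ψ z * p z) ^ 2) * Real.exp (ψ z) := by
      positivity
    have hlap : lap ψ z = pdxR (pdxR ψ) z + pdyR (pdyR ψ) z := rfl
    rw [hdP, hdQ, hsp, hsq]
    simp only [hA, hL, hlap]
    refine le_of_sub_nonneg (le_of_le_of_eq hB ?_)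
    ring
  have := integral_mono (hLi.add (hPi.fun_add hQi)) hAi hpt
  simp only [Pi.add_apply] at this
  rw [integral_add hLi (hPi.fun_add hQi), integral_add hPi hQi, hP0, hQ0] at this
  simpa using this

/-- The weighted Carleman inequality for the Cauchy–Riemann operator. -/
lemma integral_lap_mul_normSq_le {ψ : ℂ → ℝ} (hψ : ContDiff ℝ 2 ψ) {ω : ℂ → ℂ}
    (hω : ContDiff ℝ 2 ω) (hc : HasCompactSupport ω) :
    ∫ z, lap ψ z * ‖ω z‖ ^ 2 * Real.exp (ψ z) ≤
      ∫ z, ‖pdx ω z + Complex.I * pdy ω z‖ ^ 2 * Real.exp (ψ z) := by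
  have hp : ContDiff ℝ 2 (fun z => (ω z).re) := Complex.reCLM.contDiff.comp hω
  have hq : ContDiff ℝ 2 (fun z => (ω z).im) := Complex.imCLM.contDiff.comp hω
  have h := integral_lap_mul_le_of_real hψ hp hq (hc.comp_left (g := Complex.re) rfl)
    (hc.comp_left (g := Complex.im) rfl)
  have hdr : ∀ z v, fderiv ℝ (fun z => (ω z).re) z v = (fderiv ℝ ω z v).re := fun z v => by
    have := (Complex.reCLM.hasFDerivAt.comp z
      ((hω.differentiable two_ne_zero).differentiableAt (x := z)).hasFDerivAt).fderiv
    exact congrArg (fun L : ℂ →L[ℝ] ℝ => L v) this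
  have hdi : ∀ z v, fderiv ℝ (fun z => (ω z).im) z v = (fderiv ℝ ω z v).im := fun z v => by
    have := (Complex.imCLM.hasFDerivAt.comp z
      ((hω.differentiable two_ne_zero).differentiableAt (x := z)).hasFDerivAt).fderiv
    exact congrArg (fun L : ℂ →L[ℝ] ℝ => L v) this
  convert h using 4 with z z
  · rw [← Complex.normSq_eq_norm_sq, Complex.normSq_apply]; ring
  · rw [← Complex.normSq_eq_norm_sq, Complex.normSq_apply]
    simp [pdx, pdy, pdxR, pdyR, hdr, hdi]
    ring

end Carleman

section Duality

lemma sq_norm_eq_integral_of_ae_eq (u : Lp ℂ 2 (volume : Measure ℂ)) {f : ℂ → ℂ}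
    (h : u =ᵐ[volume] f) : ‖u‖ ^ 2 = ∫ z, ‖f z‖ ^ 2 := by
  have h1 : ((‖u‖ ^ 2 : ℝ) : ℂ) = ((∫ z, ‖f z‖ ^ 2 : ℝ) : ℂ) := by
    have := inner_self_eq_norm_sq_to_K (𝕜 := ℂ) u
    rw [L2.inner_def] at this
    push_cast
    rw [← integral_complex_ofReal]
    refine Eq.trans this.symm (integral_congr_ae ?_)
    filter_upwards [h] with z hz
    rw [hz, inner_self_eq_norm_sq_to_K]
    simp
  exact_mod_cast h1

/-- The functions `exp (ψ / 2) * ∂̄ω` for compactly supported `ω` of class `C²`, as a subspace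
of `L²`. -/
noncomputable def weightedDbarRange (ψ : ℂ → ℝ) : Submodule ℂ (Lp ℂ 2 (volume : Measure ℂ)) where
  carrier := {u | ∃ ω : ℂ → ℂ, ContDiff ℝ 2 ω ∧ HasCompactSupport ω ∧
    u =ᵐ[volume] fun z => (Real.exp (ψ z / 2) : ℂ) * (pdx ω z + Complex.I * pdy ω z)}
  zero_mem' := by
    refine ⟨fun _ => 0, contDiff_const, HasCompactSupport.zero, ?_⟩
    filter_upwards [Lp.coeFn_zero ℂ 2 (volume : Measure ℂ)] with z hz
    simp [pdx, pdy]
  add_mem' := by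
    rintro u v ⟨ω, hω, hωc, hu⟩ ⟨η, hη, hηc, hv⟩
    refine ⟨ω + η, hω.add hη, hωc.add hηc, ?_⟩
    filter_upwards [Lp.coeFn_add u v, hu, hv] with z h1 h2 h3
    rw [h1, Pi.add_apply, h2, h3]
    have hd : fderiv ℝ (ω + η) z = fderiv ℝ ω z + fderiv ℝ η z :=
      fderiv_add (hω.differentiable two_ne_zero).differentiableAt
        (hη.differentiable two_ne_zero).differentiableAt
    simp only [pdx, pdy, hd, add_apply]
    ring
  smul_mem' := by
    rintro c u ⟨ω, hω, hωc, hu⟩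
    refine ⟨fun z => c * ω z, contDiff_const.mul hω, hωc.mul_left, ?_⟩
    filter_upwards [Lp.coeFn_smul c u, hu] with z h1 h2
    rw [h1, Pi.smul_apply, h2]
    have hd : fderiv ℝ (fun z => c * ω z) z = c • fderiv ℝ ω z :=
      fderiv_const_mul (hω.differentiable two_ne_zero).differentiableAt c
    simp only [pdx, pdy, hd, smul_apply, smul_eq_mul]
    ring

lemma exists_mem_weightedDbarRange {ψ : ℂ → ℝ} (hψ : Continuous ψ) {ω : ℂ → ℂ}
    (hω : ContDiff ℝ 2 ω) (hc : HasCompactSupport ω) :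
    ∃ u ∈ weightedDbarRange ψ,
      u =ᵐ[volume] fun z => (Real.exp (ψ z / 2) : ℂ) * (pdx ω z + Complex.I * pdy ω z) := by
  have hcont : Continuous
      fun z => (Real.exp (ψ z / 2) : ℂ) * (pdx ω z + Complex.I * pdy ω z) := by
    have h1 : Continuous (pdx ω) := (hω.fderiv_apply_const 1).continuous
    have h2 : Continuous (pdy ω) := (hω.fderiv_apply_const Complex.I).continuous
    fun_prop
  have hcs : HasCompactSupport
      fun z => (Real.exp (ψ z / 2) : ℂ) * (pdx ω z + Complex.I * pdy ω z) := by
    refine HasCompactSupport.intro hc.isCompact fun z hz => ?_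
    have : fderiv ℝ ω z = 0 :=
      image_eq_zero_of_notMem_tsupport fun h => hz (tsupport_fderiv_subset ℝ h)
    simp [pdx, pdy, this]
  have hm := hcont.memLp_of_hasCompactSupport (p := 2) (μ := volume) hcs
  exact ⟨hm.toLp, ⟨ω, hω, hc, hm.coeFn_toLp⟩, hm.coeFn_toLp⟩

/-- A function orthogonal to `weightedDbarRange ψ` is, up to conjugation, the product of
`exp (-ψ / 2)` with an entire function. -/
lemma exists_entire_of_mem_orthogonal {ψ : ℂ → ℝ} (hψ : Continuous ψ)
    {v : Lp ℂ 2 (volume : Measure ℂ)} (hv : v ∈ (weightedDbarRange ψ)ᗮ) (hv0 : v ≠ 0) :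
    ∃ F : ℂ → ℂ, Differentiable ℂ F ∧ F ≠ 0 ∧
      Integrable fun z => ‖F z‖ ^ 2 * Real.exp (-ψ z) := by
  have hvL : LocallyIntegrable v volume := (Lp.memLp v).locallyIntegrable (by norm_num)
  set F₀ : ℂ → ℂ := fun z => (Real.exp (ψ z / 2) : ℂ) * (starRingEnd ℂ) (v z) with hF₀
  have hF₀L : LocallyIntegrable F₀ volume := by
    rw [locallyIntegrable_iff]
    intro K hK
    have h1 : IntegrableOn (fun z => (starRingEnd ℂ) (v z)) K :=
      Complex.conjCLE.toContinuousLinearMap.integrable_comp (hvL.integrableOn_isCompact hK)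
    exact h1.continuousOn_mul (by fun_prop) hK
  obtain ⟨F, hF, hFae⟩ := exists_entire_ae_eq hF₀L (by
    intro ω hω hωc
    have hω' : ContDiff ℝ 2 (fun z => (ω z : ℂ)) := Complex.ofRealCLM.contDiff.comp hω
    obtain ⟨u, hu, hue⟩ := exists_mem_weightedDbarRange hψ hω'
      (hωc.comp_left (g := ((↑) : ℝ → ℂ)) (by simp))
    have hd : ∀ z w, fderiv ℝ (fun z => (ω z : ℂ)) z w = (fderiv ℝ ω z w : ℂ) := fun z w => by
      have := (Complex.ofRealCLM.hasFDerivAt.comp z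
        ((hω.differentiable two_ne_zero).differentiableAt (x := z)).hasFDerivAt).fderiv
      exact congrArg (fun L : ℂ →L[ℝ] ℂ => L w) this
    have h0 := (Submodule.mem_orthogonal' _ _).1 hv u hu
    rw [L2.inner_def] at h0
    rw [← h0]
    refine integral_congr_ae ?_
    filter_upwards [hue] with z hz
    simp only [hF₀, hz, pdxR, pdyR, pdx, pdy, hd, RCLike.inner_apply]
    ring)
  have hnorm : ∀ᵐ z, ‖F z‖ ^ 2 * Real.exp (-ψ z) = ‖v z‖ ^ 2 := by
    filter_upwards [hFae] with z hz
    rw [← hz]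
    simp only [hF₀, norm_mul, Complex.norm_real, Real.norm_eq_abs, Real.abs_exp,
      RCLike.norm_conj, mul_pow]
    rw [← Real.exp_nat_mul, mul_right_comm, ← Real.exp_add]
    ring_nf
    simp
  refine ⟨F, hF, ?_, ?_⟩
  · rintro rfl
    apply hv0
    rw [Lp.eq_zero_iff_ae_eq_zero]
    filter_upwards [hnorm] with z hz
    simpa using hz.symm
  · refine Integrable.congr ?_ (hnorm.mono fun z hz => hz.symm)
    exact (memLp_two_iff_integrable_sq_norm (Lp.aestronglyMeasurable v)).1 (Lp.memLp v)

lemma integral_mul_dbar_eq_neg {χ : ℂ → ℝ} (hχ : ContDiff ℝ 2 χ) (hχc : HasCompactSupport χ)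
    {ω : ℂ → ℂ} (hω : ContDiff ℝ 2 ω) :
    ∫ z, (χ z : ℂ) * (pdx ω z + Complex.I * pdy ω z)
      = -∫ z, ((pdxR χ z : ℂ) + Complex.I * (pdyR χ z : ℂ)) * ω z := by
  have hχ' : ContDiff ℝ 2 (fun z => (χ z : ℂ)) := Complex.ofRealCLM.contDiff.comp hχ
  have hG : ContDiff ℝ 1 (fun z => (χ z : ℂ) * ω z) := (hχ'.mul hω).of_le one_le_two
  have hGc : HasCompactSupport (fun z => (χ z : ℂ) * ω z) :=
    (hχc.comp_left (g := ((↑) : ℝ → ℂ)) (by simp)).mul_right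
  have hd : ∀ z v, fderiv ℝ (fun z => (χ z : ℂ) * ω z) z v
      = (fderiv ℝ χ z v : ℂ) * ω z + (χ z : ℂ) * fderiv ℝ ω z v := by
    intro z v
    refine fderiv_apply_eq_of_hasDerivAt_line (hG.differentiable one_ne_zero).differentiableAt ?_
    have h1 := (((hχ.differentiable two_ne_zero).differentiableAt (x := z)).hasDerivAt_line
      v).ofReal_comp
    have h2 := ((hω.differentiable two_ne_zero).differentiableAt (x := z)).hasDerivAt_line v
    refine (h1.mul h2).congr_deriv ?_
    simp
  have hi : ∀ v, Integrable (fun z => fderiv ℝ (fun z => (χ z : ℂ) * ω z) z v) := fun v =>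
    (hG.continuous_fderiv_apply one_ne_zero |>.comp
      (continuous_id.prodMk continuous_const)).integrable_of_hasCompactSupport
      ((hGc.fderiv ℝ).comp_left (g := fun L : ℂ →L[ℝ] ℂ => L v) (by simp))
  have hx := integral_fderiv_apply_eq_zero hG hGc 1
  have hy := integral_fderiv_apply_eq_zero hG hGc Complex.I
  have hs : ∫ z, (fderiv ℝ (fun z => (χ z : ℂ) * ω z) z 1
      + Complex.I * fderiv ℝ (fun z => (χ z : ℂ) * ω z) z Complex.I) = 0 := by
    rw [integral_add (hi 1) ((hi _).const_mul _), integral_const_mul, hx, hy]; simp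
  have hcx : Continuous (pdx ω) := (hω.fderiv_apply_const 1).continuous
  have hcy : Continuous (pdy ω) := (hω.fderiv_apply_const Complex.I).continuous
  have hcχx : Continuous (pdxR χ) := (hχ.fderiv_apply_const 1).continuous
  have hcχy : Continuous (pdyR χ) := (hχ.fderiv_apply_const Complex.I).continuous
  have hcχ := hχ.continuous
  have hcω := hω.continuous
  have hi1 : Integrable (fun z => (χ z : ℂ) * (pdx ω z + Complex.I * pdy ω z)) :=
    Continuous.integrable_of_hasCompactSupport (by fun_prop)
      (hχc.comp_left (g := ((↑) : ℝ → ℂ)) (by simp)).mul_right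
  have hi2 : Integrable (fun z => ((pdxR χ z : ℂ) + Complex.I * (pdyR χ z : ℂ)) * ω z) := by
    refine Continuous.integrable_of_hasCompactSupport (by fun_prop)
      (HasCompactSupport.intro hχc.isCompact fun z hz => ?_)
    have : fderiv ℝ χ z = 0 :=
      image_eq_zero_of_notMem_tsupport fun h => hz (tsupport_fderiv_subset ℝ h)
    simp [pdxR, pdyR, this]
  rw [eq_neg_iff_add_eq_zero, ← integral_add hi1 hi2, ← hs]
  congr 1
  funext z
  simp only [hd, pdx, pdy, pdxR, pdyR]
  ring

/-- Existence of weighted square-integrable entire functions from a test function violating the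
dual estimate. -/
lemma exists_entire_of_integral_lt {ψ : ℂ → ℝ} (hψ : ContDiff ℝ 2 ψ) (hsub : ∀ z, 0 ≤ lap ψ z)
    {χ : ℂ → ℝ} (hχ : ContDiff ℝ 2 χ) (hχc : HasCompactSupport χ) {c : ℝ} (hc : 0 < c)
    (hχψ : ∀ z, fderiv ℝ χ z ≠ 0 → c ≤ lap ψ z)
    (hlt : ∫ z, ‖(pdxR χ z : ℂ) + Complex.I * (pdyR χ z : ℂ)‖ ^ 2 * Real.exp (-ψ z)
      < c * ∫ z, χ z ^ 2 * Real.exp (-ψ z)) :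
    ∃ F : ℂ → ℂ, Differentiable ℂ F ∧ F ≠ 0 ∧
      Integrable fun z => ‖F z‖ ^ 2 * Real.exp (-ψ z) := by
  have hψc := hψ.continuous
  have hcχ := hχ.continuous
  have hcχx : Continuous (pdxR χ) := (hχ.fderiv_apply_const 1).continuous
  have hcχy : Continuous (pdyR χ) := (hχ.fderiv_apply_const Complex.I).continuous
  set D := ∫ z, ‖(pdxR χ z : ℂ) + Complex.I * (pdyR χ z : ℂ)‖ ^ 2 * Real.exp (-ψ z) with hD
  have hTm : MemLp (fun z => ((χ z * Real.exp (-ψ z / 2) : ℝ) : ℂ)) 2 (volume : Measure ℂ) :=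
    Continuous.memLp_of_hasCompactSupport (by fun_prop)
      (hχc.mul_right.comp_left (g := ((↑) : ℝ → ℂ)) (by simp))
  set T := hTm.toLp with hT
  have hTe := hTm.coeFn_toLp
  have hTn : ‖T‖ ^ 2 = ∫ z, χ z ^ 2 * Real.exp (-ψ z) := by
    rw [sq_norm_eq_integral_of_ae_eq T hTe]
    congr 1
    funext z
    rw [Complex.norm_real, Real.norm_eq_abs, sq_abs, mul_pow, ← Real.exp_nat_mul]
    ring_nf
  have hbound : ∀ u ∈ weightedDbarRange ψ, 2 * ‖inner ℂ T u‖ ≤ D / c + ‖u‖ ^ 2 := by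
    rintro u ⟨ω, hω, hωc, hu⟩
    have hcω := hω.continuous
    have hin : inner ℂ T u
        = -∫ z, ((pdxR χ z : ℂ) + Complex.I * (pdyR χ z : ℂ)) * ω z := by
      rw [← integral_mul_dbar_eq_neg hχ hχc hω, L2.inner_def]
      refine integral_congr_ae ?_
      filter_upwards [hTe, hu] with z h1 h2
      have he : (Real.exp (ψ z / 2) : ℂ) * (Real.exp (-ψ z / 2) : ℂ) = 1 := by
        rw [← Complex.ofReal_mul, ← Real.exp_add]; simp [neg_div]
      rw [h1, h2, RCLike.inner_apply, Complex.conj_ofReal, Complex.ofReal_mul]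
      linear_combination (χ z : ℂ) * (pdx ω z + Complex.I * pdy ω z) * he
    have hun : ‖u‖ ^ 2 = ∫ z, ‖pdx ω z + Complex.I * pdy ω z‖ ^ 2 * Real.exp (ψ z) := by
      rw [sq_norm_eq_integral_of_ae_eq u hu]
      congr 1
      funext z
      rw [norm_mul, Complex.norm_real, Real.norm_eq_abs, Real.abs_exp, mul_pow, ← Real.exp_nat_mul]
      ring_nf
    have hcar := integral_lap_mul_normSq_le hψ hω hωc
    have hlc := hψ.continuous_lap
    have hz0 : ∀ z ∉ tsupport χ, fderiv ℝ χ z = 0 := fun z hz =>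
      image_eq_zero_of_notMem_tsupport fun h => hz (tsupport_fderiv_subset ℝ h)
    have i1 : Integrable (fun z => ‖(pdxR χ z : ℂ) + Complex.I * (pdyR χ z : ℂ)‖ ^ 2
        * Real.exp (-ψ z)) :=
      Continuous.integrable_of_hasCompactSupport (by fun_prop)
        (HasCompactSupport.intro hχc.isCompact fun z hz => by simp [pdxR, pdyR, hz0 z hz])
    have i2 : Integrable (fun z => lap ψ z * ‖ω z‖ ^ 2 * Real.exp (ψ z)) :=
      Continuous.integrable_of_hasCompactSupport (by fun_prop)
        (HasCompactSupport.intro hωc.isCompact fun z hz => by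
          simp [image_eq_zero_of_notMem_tsupport hz])
    have i3 : Integrable (fun z => ‖((pdxR χ z : ℂ) + Complex.I * (pdyR χ z : ℂ)) * ω z‖) :=
      Continuous.integrable_of_hasCompactSupport (by fun_prop)
        (HasCompactSupport.intro hωc.isCompact fun z hz => by
          simp [image_eq_zero_of_notMem_tsupport hz])
    rw [hin, norm_neg, hun]
    calc 2 * ‖∫ z, ((pdxR χ z : ℂ) + Complex.I * (pdyR χ z : ℂ)) * ω z‖
        ≤ 2 * ∫ z, ‖((pdxR χ z : ℂ) + Complex.I * (pdyR χ z : ℂ)) * ω z‖ := by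
          gcongr; exact norm_integral_le_integral_norm _
      _ = ∫ z, 2 * ‖((pdxR χ z : ℂ) + Complex.I * (pdyR χ z : ℂ)) * ω z‖ := by
          rw [integral_const_mul]
      _ ≤ ∫ z, (‖(pdxR χ z : ℂ) + Complex.I * (pdyR χ z : ℂ)‖ ^ 2 * Real.exp (-ψ z) / c
            + lap ψ z * ‖ω z‖ ^ 2 * Real.exp (ψ z)) := by
          refine integral_mono (i3.const_mul 2) ((i1.div_const c).add i2) fun z => ?_
          simp only
          by_cases hz : fderiv ℝ χ z = 0
          · have := hsub z
            simp only [pdxR, pdyR, hz]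
            simp
            positivity
          · have hcz := hχψ z hz
            have hee : Real.exp (-ψ z) * Real.exp (ψ z) = 1 := by
              rw [← Real.exp_add]; simp
            rw [norm_mul]
            set a := ‖(pdxR χ z : ℂ) + Complex.I * (pdyR χ z : ℂ)‖
            set b := ‖ω z‖
            have e1 : 0 < Real.exp (-ψ z) := Real.exp_pos _
            have e2 : 0 < Real.exp (ψ z) := Real.exp_pos _
            have h1 : c * b ^ 2 * Real.exp (ψ z) ≤ lap ψ z * b ^ 2 * Real.exp (ψ z) := by
              gcongr
            have h2 : 2 * (a * b) ≤ a ^ 2 * Real.exp (-ψ z) / c + c * b ^ 2 * Real.exp (ψ z) := by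
              have h3 : 0 ≤ (a * Real.exp (-ψ z) - c * b) ^ 2 * Real.exp (ψ z) / c := by positivity
              have h4 : (a * Real.exp (-ψ z) - c * b) ^ 2 * Real.exp (ψ z) / c
                  = a ^ 2 * Real.exp (-ψ z) / c + c * b ^ 2 * Real.exp (ψ z) - 2 * (a * b) := by
                field_simp
                linear_combination (a ^ 2 * Real.exp (-ψ z) - 2 * a * b * c) * hee
              linarith
            linarith
      _ = D / c + ∫ z, lap ψ z * ‖ω z‖ ^ 2 * Real.exp (ψ z) := by
          rw [integral_add (i1.div_const c) i2, integral_div]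
      _ ≤ _ := by gcongr
  have hne : (weightedDbarRange ψ)ᗮ ≠ ⊥ := by
    intro hbot
    have htop := Submodule.topologicalClosure_eq_top_iff.2 hbot
    have hTmem : T ∈ closure (weightedDbarRange ψ : Set (Lp ℂ 2 (volume : Measure ℂ))) := by
      rw [← Submodule.topologicalClosure_coe, htop]; trivial
    have hclosed : IsClosed {u : Lp ℂ 2 (volume : Measure ℂ) |
        2 * ‖inner ℂ T u‖ ≤ D / c + ‖u‖ ^ 2} :=
      isClosed_le (by fun_prop) (by fun_prop)
    have hTT : 2 * ‖inner ℂ T T‖ ≤ D / c + ‖T‖ ^ 2 :=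
      closure_minimal (fun u hu => hbound u hu) hclosed hTmem
    rw [inner_self_eq_norm_sq_to_K] at hTT
    simp only [norm_pow, RCLike.norm_ofReal, abs_norm] at hTT
    rw [← hTn] at hlt
    have : D / c < ‖T‖ ^ 2 := by rwa [div_lt_iff₀' hc]
    linarith
  obtain ⟨v, hv, hv0⟩ := Submodule.exists_mem_ne_zero_of_ne_bot hne
  exact exists_entire_of_mem_orthogonal hψc hv hv0

end Duality

theorem lap_add {f g : ℂ → ℝ} (hf : ContDiff ℝ 2 f) (hg : ContDiff ℝ 2 g) (z : ℂ) :
    lap (fun w => f w + g w) z = lap f z + lap g z := by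
  have key : ∀ v : ℂ, fderiv ℝ (fun w => fderiv ℝ (fun w => f w + g w) w v) z v
      = fderiv ℝ (fun w => fderiv ℝ f w v) z v + fderiv ℝ (fun w => fderiv ℝ g w v) z v := by
    intro v
    have h1 : (fun w => fderiv ℝ (fun w => f w + g w) w v)
        = fun w => fderiv ℝ f w v + fderiv ℝ g w v := by
      funext w
      rw [fderiv_fun_add (hf.differentiable two_ne_zero).differentiableAt
        (hg.differentiable two_ne_zero).differentiableAt]
      rfl
    rw [h1, fderiv_fun_add ((hf.fderiv_apply_const v).differentiable one_ne_zero).differentiableAt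
      ((hg.fderiv_apply_const v).differentiable one_ne_zero).differentiableAt]
    rfl
  simp only [lap, pdxR, pdyR]
  rw [key, key]
  ring

theorem lap_const_mul {f : ℂ → ℝ} (hf : ContDiff ℝ 2 f) (c : ℝ) (z : ℂ) :
    lap (fun w => c * f w) z = c * lap f z := by
  have key : ∀ v : ℂ, fderiv ℝ (fun w => fderiv ℝ (fun w => c * f w) w v) z v
      = c * fderiv ℝ (fun w => fderiv ℝ f w v) z v := by
    intro v
    have h1 : (fun w => fderiv ℝ (fun w => c * f w) w v) = fun w => c * fderiv ℝ f w v := by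
      funext w
      rw [fderiv_const_mul (hf.differentiable two_ne_zero).differentiableAt]
      rfl
    rw [h1, fderiv_const_mul
      ((hf.fderiv_apply_const v).differentiable one_ne_zero).differentiableAt]
    rfl
  simp only [lap, pdxR, pdyR]
  rw [key, key]
  ring

theorem lap_sum {ι : Type*} (s : Finset ι) {f : ι → ℂ → ℝ} (hf : ∀ i ∈ s, ContDiff ℝ 2 (f i))
    (z : ℂ) : lap (fun w => ∑ i ∈ s, f i w) z = ∑ i ∈ s, lap (f i) z := by
  classical
  induction s using Finset.induction_on with
  | empty => simp [lap, pdxR, pdyR]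
  | insert i s hi ih =>
    have hs : ∀ j ∈ s, ContDiff ℝ 2 (f j) := fun j hj => hf j (Finset.mem_insert_of_mem hj)
    simp only [Finset.sum_insert hi]
    rw [lap_add (hf i (Finset.mem_insert_self i s)) (ContDiff.sum hs), ih hs]

theorem hasFDerivAt_normSq_sub (a w : ℂ) :
    HasFDerivAt (fun w : ℂ => Complex.normSq (w - a))
      ((2 * (w - a).re) • Complex.reCLM + (2 * (w - a).im) • Complex.imCLM) w := by
  have hre : HasFDerivAt (fun w : ℂ => (w - a).re) Complex.reCLM w :=
    Complex.reCLM.hasFDerivAt.comp w ((hasFDerivAt_id w).sub_const a)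
  have him : HasFDerivAt (fun w : ℂ => (w - a).im) Complex.imCLM w :=
    Complex.imCLM.hasFDerivAt.comp w ((hasFDerivAt_id w).sub_const a)
  refine ((hre.mul hre).add (him.mul him)).congr_fderiv ?_
  ext; simp; ring

/-- The Laplacian of a radial function, written in terms of the squared distance. -/
theorem lap_radial {H H₁ H₂ : ℝ → ℝ} (h₁ : ∀ t, 0 ≤ t → HasDerivAt H (H₁ t) t)
    (h₂ : ∀ t, 0 ≤ t → HasDerivAt H₁ (H₂ t) t) (a z : ℂ) :
    lap (fun w => H (Complex.normSq (w - a))) z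
      = 4 * (Complex.normSq (z - a) * H₂ (Complex.normSq (z - a))
          + H₁ (Complex.normSq (z - a))) := by
  have hx : (fun w => pdxR (fun w => H (Complex.normSq (w - a))) w)
      = fun w => H₁ (Complex.normSq (w - a)) * (2 * (w - a).re) := by
    funext w
    have h := (h₁ _ (Complex.normSq_nonneg (w - a))).comp_hasFDerivAt w (hasFDerivAt_normSq_sub a w)
    have h' : fderiv ℝ (fun w => H (Complex.normSq (w - a))) w = _ := h.fderiv
    rw [pdxR, h']
    simp
  have hy : (fun w => pdyR (fun w => H (Complex.normSq (w - a))) w)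
      = fun w => H₁ (Complex.normSq (w - a)) * (2 * (w - a).im) := by
    funext w
    have h := (h₁ _ (Complex.normSq_nonneg (w - a))).comp_hasFDerivAt w (hasFDerivAt_normSq_sub a w)
    have h' : fderiv ℝ (fun w => H (Complex.normSq (w - a))) w = _ := h.fderiv
    rw [pdyR, h']
    simp
  have hre : HasFDerivAt (fun w : ℂ => 2 * (w - a).re) ((2 : ℝ) • Complex.reCLM) z := by
    simpa using (Complex.reCLM.hasFDerivAt.comp z ((hasFDerivAt_id z).sub_const a)).const_mul 2
  have him : HasFDerivAt (fun w : ℂ => 2 * (w - a).im) ((2 : ℝ) • Complex.imCLM) z := by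
    simpa using (Complex.imCLM.hasFDerivAt.comp z ((hasFDerivAt_id z).sub_const a)).const_mul 2
  have h := (h₂ _ (Complex.normSq_nonneg (z - a))).comp_hasFDerivAt z (hasFDerivAt_normSq_sub a z)
  have hxx := (h.mul hre).fderiv
  have hyy := (h.mul him).fderiv
  rw [lap, hx, hy, pdxR, pdyR]
  erw [hxx, hyy]
  simp only [Function.comp, Complex.normSq_apply]
  simp
  ring

/-- The derivative of the radial profile of `exists_logBarrier`. -/
noncomputable def barrierSlope (t : ℝ) : ℝ := (max 1 t)⁻¹ + max 1 t - t

theorem continuous_barrierSlope : Continuous barrierSlope := by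
  unfold barrierSlope
  have : ∀ t : ℝ, max 1 t ≠ 0 := fun t => (lt_max_of_lt_left one_pos).ne'
  fun_prop (disch := exact this _)

theorem hasDerivAt_barrierSlope (t : ℝ) :
    HasDerivAt barrierSlope (-((max 1 t) ^ 2)⁻¹) t := by
  have hne : ∀ t : ℝ, max 1 t ≠ 0 := fun t => (lt_max_of_lt_left one_pos).ne'
  have key : ∀ y : ℝ, y ≠ 1 → HasDerivAt barrierSlope (-((max 1 y) ^ 2)⁻¹) y := by
    intro y hy
    rcases lt_or_gt_of_ne hy with h | h
    · have he : barrierSlope =ᶠ[nhds y] fun t => 2 - t := by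
        filter_upwards [Iio_mem_nhds h] with s hs
        rw [barrierSlope, max_eq_left hs.le]
        ring
      rw [max_eq_left h.le]
      refine HasDerivAt.congr_of_eventuallyEq ?_ he
      simpa using (hasDerivAt_id y).const_sub 2
    · have he : barrierSlope =ᶠ[nhds y] fun t => t⁻¹ := by
        filter_upwards [Ioi_mem_nhds h] with s hs
        rw [barrierSlope, max_eq_right hs.le]
        ring
      rw [max_eq_right h.le]
      exact HasDerivAt.congr_of_eventuallyEq (hasDerivAt_inv (by positivity)) he
  by_cases ht : t = 1
  · subst ht
    refine hasDerivAt_of_hasDerivAt_of_ne (g := fun t : ℝ => -((max 1 t) ^ 2)⁻¹) key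
      continuous_barrierSlope.continuousAt ?_
    have : ∀ t : ℝ, max 1 t ^ 2 ≠ 0 := fun t => pow_ne_zero 2 (hne t)
    exact Continuous.continuousAt (by fun_prop (disch := exact this _))
  · exact key t ht

theorem inv_one_add_le_barrierSlope {t : ℝ} (ht : 0 ≤ t) : (1 + t)⁻¹ ≤ barrierSlope t := by
  rcases le_total t 1 with h | h
  · rw [barrierSlope, max_eq_left h, inv_le_comm₀ (by positivity) (by norm_num; linarith)]
    rw [inv_le_iff_one_le_mul₀ (by norm_num; linarith)]
    norm_num
    nlinarith
  · rw [barrierSlope, max_eq_right h, add_sub_cancel_right]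
    exact inv_anti₀ (by linarith) (by linarith)

/-- The radial profile of `exists_logBarrier`. -/
noncomputable def barrierProfile (t : ℝ) : ℝ := ∫ s in (0 : ℝ)..t, barrierSlope s

theorem hasDerivAt_barrierProfile (t : ℝ) : HasDerivAt barrierProfile (barrierSlope t) t :=
  intervalIntegral.integral_hasDerivAt_right (continuous_barrierSlope.intervalIntegrable 0 t)
    (continuous_barrierSlope.stronglyMeasurableAtFilter _ _) continuous_barrierSlope.continuousAt

theorem contDiff_barrierProfile : ContDiff ℝ 2 barrierProfile := by
  have h1 : ContDiff ℝ 1 barrierSlope := by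
    have hne : ∀ t : ℝ, max 1 t ^ 2 ≠ 0 :=
      fun t => pow_ne_zero 2 (lt_max_of_lt_left one_pos).ne'
    rw [contDiff_one_iff_deriv, funext fun t => (hasDerivAt_barrierSlope t).deriv]
    exact ⟨fun t => (hasDerivAt_barrierSlope t).differentiableAt,
      by fun_prop (disch := exact hne _)⟩
  rw [show (2 : WithTop ℕ∞) = 1 + 1 by norm_num, contDiff_succ_iff_deriv,
    funext fun t => (hasDerivAt_barrierProfile t).deriv]
  exact ⟨fun t => (hasDerivAt_barrierProfile t).differentiableAt, by simp, h1⟩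

theorem log_one_add_le_barrierProfile {t : ℝ} (ht : 0 ≤ t) :
    Real.log (1 + t) ≤ barrierProfile t := by
  have hd : ∀ s : ℝ, 0 ≤ s → HasDerivAt (fun s => barrierProfile s - Real.log (1 + s))
      (barrierSlope s - (1 + s)⁻¹) s := by
    intro s hs
    have := (((hasDerivAt_id s).const_add 1).log (by simp only [id]; positivity))
    exact ((hasDerivAt_barrierProfile s).sub this).congr_deriv (by simp)
  have hmono : MonotoneOn (fun s => barrierProfile s - Real.log (1 + s)) (Set.Ici 0) := by
    refine monotoneOn_of_deriv_nonneg (convex_Ici 0)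
      (fun s hs => (hd s hs).continuousAt.continuousWithinAt)
      (fun s hs => (hd s (interior_subset hs)).differentiableAt.differentiableWithinAt)
      fun s hs => ?_
    rw [(hd s (interior_subset hs)).deriv, sub_nonneg]
    exact inv_one_add_le_barrierSlope (interior_subset hs)
  have h := hmono (Set.mem_Ici.2 le_rfl) ht ht
  simpa [barrierProfile] using h

/-- A function of logarithmic growth whose Laplacian is positive only on a given ball. -/
theorem exists_logBarrier (a : ℂ) {r : ℝ} (hr : 0 < r) :
    ∃ b : ℂ → ℝ, ContDiff ℝ 2 b ∧ (∀ z ∈ Metric.closedBall a r, lap b z ≤ 8 / r ^ 2) ∧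
      (∀ z ∉ Metric.closedBall a r, lap b z ≤ 0) ∧
      ∃ C, ∀ z, Real.log (1 + ‖z‖ ^ 2) - C ≤ b z := by
  have hnsq : ContDiff ℝ 2 fun w : ℂ => Complex.normSq (w - a) := by
    have : (fun w : ℂ => Complex.normSq (w - a)) = fun w => ‖w - a‖ ^ 2 :=
      funext fun w => Complex.normSq_eq_norm_sq _
    rw [this]
    exact (contDiff_id.sub contDiff_const).norm_sq ℝ
  have hlap : ∀ z, lap (fun w => barrierProfile (Complex.normSq (w - a) / r ^ 2)) z
      = 4 * (Complex.normSq (z - a)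
          * (-((max 1 (Complex.normSq (z - a) / r ^ 2)) ^ 2)⁻¹ / r ^ 2 / r ^ 2)
        + barrierSlope (Complex.normSq (z - a) / r ^ 2) / r ^ 2) := by
    intro z
    have hs : ∀ t : ℝ, HasDerivAt (fun t => t / r ^ 2) (1 / r ^ 2) t :=
      fun t => (hasDerivAt_id t).div_const _
    refine lap_radial (H := fun t => barrierProfile (t / r ^ 2))
      (H₁ := fun t => barrierSlope (t / r ^ 2) / r ^ 2)
      (H₂ := fun t => -((max 1 (t / r ^ 2)) ^ 2)⁻¹ / r ^ 2 / r ^ 2)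
      (fun t _ => ?_) (fun t _ => ?_) a z
    · refine ((hasDerivAt_barrierProfile (t / r ^ 2)).comp t (hs t)).congr_deriv ?_
      ring
    · refine (((hasDerivAt_barrierSlope (t / r ^ 2)).comp t (hs t)).div_const _).congr_deriv ?_
      ring
  refine ⟨fun w => barrierProfile (Complex.normSq (w - a) / r ^ 2),
    contDiff_barrierProfile.comp (hnsq.div_const _), fun z hz => ?_, fun z hz => ?_,
    Real.log (1 + 2 * ‖a‖ ^ 2 + 2 * r ^ 2), fun z => ?_⟩
  · have h1 : Complex.normSq (z - a) / r ^ 2 ≤ 1 := by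
      rw [div_le_one (by positivity), Complex.normSq_eq_norm_sq, ← dist_eq_norm]
      exact pow_le_pow_left₀ dist_nonneg hz 2
    have h0 : 0 ≤ Complex.normSq (z - a) / r ^ 2 := by
      have := Complex.normSq_nonneg (z - a)
      positivity
    rw [hlap, barrierSlope, max_eq_left h1, le_div_iff₀ (by positivity)]
    have : 4 * (Complex.normSq (z - a) * (-(1 ^ 2)⁻¹ / r ^ 2 / r ^ 2)
        + (1⁻¹ + 1 - Complex.normSq (z - a) / r ^ 2) / r ^ 2) * r ^ 2
        = 8 - 8 * (Complex.normSq (z - a) / r ^ 2) := by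
      field_simp
      ring
    linarith
  · have h1 : 1 ≤ Complex.normSq (z - a) / r ^ 2 := by
      rw [one_le_div (by positivity), Complex.normSq_eq_norm_sq, ← dist_eq_norm]
      exact pow_le_pow_left₀ hr.le (not_le.1 hz).le 2
    have hpos : Complex.normSq (z - a) ≠ 0 := by
      intro h
      rw [h] at h1
      norm_num at h1
    rw [hlap, barrierSlope, max_eq_right h1]
    apply le_of_eq
    field_simp
    ring
  · refine le_trans ?_ (log_one_add_le_barrierProfile (by
      have := Complex.normSq_nonneg (z - a)
      positivity))
    rw [sub_le_iff_le_add, Complex.normSq_eq_norm_sq,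
      ← Real.log_mul (by positivity) (by positivity)]
    apply Real.log_le_log (by positivity)
    have h1 : ‖z‖ ≤ ‖z - a‖ + ‖a‖ := by simpa using norm_add_le (z - a) a
    have h2 : ‖z‖ ^ 2 ≤ 2 * ‖z - a‖ ^ 2 + 2 * ‖a‖ ^ 2 := by
      have := pow_le_pow_left₀ (norm_nonneg z) h1 2
      nlinarith [sq_nonneg (‖z - a‖ - ‖a‖)]
    have h3 : (1 + ‖z - a‖ ^ 2 / r ^ 2) * (1 + 2 * ‖a‖ ^ 2 + 2 * r ^ 2)
        = 1 + 2 * ‖a‖ ^ 2 + 2 * r ^ 2 + 2 * ‖z - a‖ ^ 2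
          + ‖z - a‖ ^ 2 / r ^ 2 * (1 + 2 * ‖a‖ ^ 2) := by
      field_simp
      ring
    have h4 : 0 ≤ ‖z - a‖ ^ 2 / r ^ 2 * (1 + 2 * ‖a‖ ^ 2) := by positivity
    rw [h3]
    nlinarith [sq_nonneg r]

/-- A nontrivial doubling measure on the plane has infinite mass. -/
theorem measure_univ_eq_top_of_doubling {μ : Measure ℂ} (hμ : μ ≠ 0) {C : ℝ}
    (hd : ∀ (z : ℂ) (r : ℝ), 0 < r →
      μ (Metric.ball z r) ≤ ENNReal.ofReal C * μ (Metric.ball z (r / 2))) :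
    μ Set.univ = ⊤ := by
  by_contra hfin
  have hU : ⋃ n : ℕ, Metric.ball (0 : ℂ) n = Set.univ := Metric.iUnion_ball_nat 0
  obtain ⟨N, hN⟩ : ∃ N : ℕ, 0 < μ (Metric.ball (0 : ℂ) N) := by
    by_contra! h
    apply hμ
    rw [← Measure.measure_univ_eq_zero, ← hU, measure_iUnion_null_iff]
    exact fun n => le_antisymm (h n) zero_le
  have hbound : ∀ n : ℕ, 0 < n → N ≤ n → μ (Metric.ball (0 : ℂ) N)
      ≤ ENNReal.ofReal C * (ENNReal.ofReal C * μ (Metric.ball (0 : ℂ) n)ᶜ) := by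
    intro n hn hNn
    have hn' : (0 : ℝ) < n := by exact_mod_cast hn
    have hNn' : (N : ℝ) ≤ n := by exact_mod_cast hNn
    have h1 := hd (3 * n : ℝ) (4 * n) (by positivity)
    have h2 := hd (3 * n : ℝ) (4 * n / 2) (by positivity)
    have h3 : Metric.ball (0 : ℂ) N ⊆ Metric.ball ((3 * n : ℝ) : ℂ) (4 * n) := by
      refine Metric.ball_subset_ball' ?_
      rw [dist_zero_left, Complex.norm_real, Real.norm_of_nonneg (by positivity)]
      linarith
    have h4 : Metric.ball ((3 * n : ℝ) : ℂ) (4 * n / 2 / 2) ⊆ (Metric.ball (0 : ℂ) n)ᶜ := by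
      refine Disjoint.subset_compl_right (Metric.ball_disjoint_ball ?_)
      rw [dist_zero_right, Complex.norm_real, Real.norm_of_nonneg (by positivity)]
      linarith
    calc μ (Metric.ball (0 : ℂ) N) ≤ μ (Metric.ball ((3 * n : ℝ) : ℂ) (4 * n)) := measure_mono h3
      _ ≤ _ := h1
      _ ≤ ENNReal.ofReal C * (ENNReal.ofReal C * μ (Metric.ball (0 : ℂ) n)ᶜ) := by
        gcongr
        exact h2.trans (by gcongr)
  have htend : Filter.Tendsto (fun n : ℕ => μ (Metric.ball (0 : ℂ) n)ᶜ) Filter.atTop (nhds 0) := by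
    have h := tendsto_measure_iInter_atTop (μ := μ) (s := fun n : ℕ => (Metric.ball (0 : ℂ) n)ᶜ)
      (fun n => Metric.isOpen_ball.measurableSet.compl.nullMeasurableSet)
      (fun m n hmn => Set.compl_subset_compl.2 (Metric.ball_subset_ball (by exact_mod_cast hmn)))
      ⟨0, measure_ne_top_of_subset (Set.subset_univ _) hfin⟩
    rwa [← Set.compl_iUnion, hU, Set.compl_univ, measure_empty] at h
  have hlim : Filter.Tendsto
      (fun n : ℕ => ENNReal.ofReal C * (ENNReal.ofReal C * μ (Metric.ball (0 : ℂ) n)ᶜ))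
      Filter.atTop (nhds 0) := by
    simpa using ENNReal.Tendsto.const_mul
      (ENNReal.Tendsto.const_mul htend (Or.inr ENNReal.ofReal_ne_top))
      (Or.inr (ENNReal.ofReal_ne_top (r := C)))
  refine hN.not_ge (ge_of_tendsto hlim ?_)
  filter_upwards [Filter.eventually_ge_atTop (N + 1)] with n hn
  exact hbound n (by omega) (by omega)

/-- If `Δφ` has infinite mass, part of it can be swept into a function growing faster than any
given multiple of `log (1 + |z|²)`. -/
theorem exists_log_minorant {φ : ℂ → ℝ} (hφ : ContDiff ℝ 2 φ) (hsub : ∀ z, 0 ≤ lap φ z)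
    (htop : (volume.withDensity fun z => ENNReal.ofReal (lap φ z)) Set.univ = ⊤) (K : ℝ) :
    ∃ η : ℂ → ℝ, ContDiff ℝ 2 η ∧ (∀ z, lap η z ≤ lap φ z / 2) ∧
      ∃ C, ∀ z, K * Real.log (1 + ‖z‖ ^ 2) - C ≤ η z := by
  classical
  set μ : Measure ℂ := volume.withDensity fun z => ENNReal.ofReal (lap φ z) with hμ
  have hcont := hφ.continuous_lap
  set s : Set ℂ := {z | 0 < lap φ z} with hs
  have hsm : MeasurableSet s := (isOpen_lt continuous_const hcont).measurableSet
  have hμs : μ s = ⊤ := by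
    have h0 : μ sᶜ = 0 := by
      rw [hμ, withDensity_apply _ hsm.compl, setLIntegral_eq_zero hsm.compl]
      intro z hz
      simpa [hs] using hz
    rw [← htop, ← measure_add_measure_compl hsm, h0, add_zero]
  obtain ⟨t, r, htc, hts, htr, hcov, hdisj⟩ :=
    Besicovitch.exists_disjoint_closedBall_covering_ae μ
      (fun x => {r | ∀ y ∈ Metric.closedBall x r, lap φ x / 2 ≤ lap φ y ∧ lap φ y ≤ 2 * lap φ x}) s
      (by
        intro x hx δ hδ
        have hx' : 0 < lap φ x := hx
        obtain ⟨ε, hε, hball⟩ := Metric.nhds_basis_closedBall.mem_iff.1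
          (hcont.continuousAt.preimage_mem_nhds (Icc_mem_nhds
            (show lap φ x / 2 < lap φ x by linarith) (show lap φ x < 2 * lap φ x by linarith)))
        refine ⟨min ε (δ / 2), fun y hy => hball ?_, by positivity, ?_⟩
        · exact Metric.closedBall_subset_closedBall (min_le_left _ _) hy
        · exact (min_le_right _ _).trans_lt (by linarith))
      (fun _ => 1) (fun _ _ => one_pos)
  have hr : ∀ x ∈ t, 0 < r x := fun x hx => (htr x hx).2.1
  have hmass : ∀ x ∈ t, μ (Metric.closedBall x (r x))
      ≤ ENNReal.ofReal (64 * Real.pi * (r x ^ 2 * lap φ x / 32)) := by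
    intro x hx
    have hx' : 0 < lap φ x := hts hx
    calc μ (Metric.closedBall x (r x))
        = ∫⁻ z in Metric.closedBall x (r x), ENNReal.ofReal (lap φ z) := by
          rw [hμ, withDensity_apply _ measurableSet_closedBall]
      _ ≤ ∫⁻ z in Metric.closedBall x (r x), ENNReal.ofReal (2 * lap φ x) :=
          setLIntegral_mono measurable_const
            fun z hz => ENNReal.ofReal_le_ofReal ((htr x hx).1 z hz).2
      _ = ENNReal.ofReal (64 * Real.pi * (r x ^ 2 * lap φ x / 32)) := by
          have hpi : (NNReal.pi : ENNReal) = ENNReal.ofReal Real.pi := by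
            rw [← NNReal.coe_real_pi, ENNReal.ofReal_coe_nnreal]
          rw [setLIntegral_const, Complex.volume_closedBall, hpi,
            ← ENNReal.ofReal_pow (hr x hx).le, ← ENNReal.ofReal_mul (by positivity),
            ← ENNReal.ofReal_mul (by positivity)]
          congr 1
          ring
  have hsum : ∑' x : t, ENNReal.ofReal (64 * Real.pi * (r x ^ 2 * lap φ x / 32)) = ⊤ := by
    have : Countable t := htc.to_subtype
    rw [eq_top_iff, ← hμs]
    calc μ s ≤ μ ((⋃ x ∈ t, Metric.closedBall x (r x))
            ∪ (s \ ⋃ x ∈ t, Metric.closedBall x (r x))) := by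
          refine measure_mono fun z hz => ?_
          by_cases h : z ∈ ⋃ x ∈ t, Metric.closedBall x (r x)
          · exact Or.inl h
          · exact Or.inr ⟨hz, h⟩
      _ ≤ μ (⋃ x ∈ t, Metric.closedBall x (r x)) + 0 := by
          rw [← hcov]
          exact measure_union_le _ _
      _ ≤ ∑' x : t, μ (Metric.closedBall (x : ℂ) (r x)) := by
          rw [add_zero]
          exact measure_biUnion_le μ htc _
      _ ≤ _ := ENNReal.tsum_le_tsum fun x => hmass x x.2
  have hκ : ∀ x : t, 0 ≤ r x ^ 2 * lap φ x / 32 := fun x => by have := hsub x; positivity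
  obtain ⟨F, hF⟩ : ∃ F : Finset t, K ≤ ∑ x ∈ F, r x ^ 2 * lap φ x / 32 := by
    rw [ENNReal.tsum_eq_iSup_sum, iSup_eq_top] at hsum
    obtain ⟨F, hF⟩ := hsum (ENNReal.ofReal (64 * Real.pi * K)) ENNReal.ofReal_lt_top
    refine ⟨F, ?_⟩
    rw [← ENNReal.ofReal_sum_of_nonneg (fun x _ => mul_nonneg (by positivity) (hκ x)),
      ← Finset.mul_sum] at hF
    have h' := (ENNReal.le_ofReal_iff_toReal_le ENNReal.ofReal_ne_top
      (mul_nonneg (by positivity) (Finset.sum_nonneg fun x _ => hκ x))).1 hF.le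
    have h'' : 64 * Real.pi * K ≤ 64 * Real.pi * ∑ x ∈ F, r x ^ 2 * lap φ x / 32 := by
      refine le_trans ?_ h'
      rw [ENNReal.toReal_ofReal']
      exact le_max_left _ _
    exact le_of_mul_le_mul_left h'' (by positivity)
  choose b hb hbin hbout Cb hCb using fun x : t => exists_logBarrier (x : ℂ) (hr x x.2)
  refine ⟨fun z => ∑ x ∈ F, r x ^ 2 * lap φ x / 32 * b x z,
    ContDiff.sum fun x _ => contDiff_const.mul (hb x), fun z => ?_,
    ∑ x ∈ F, r x ^ 2 * lap φ x / 32 * Cb x, fun z => ?_⟩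
  · rw [lap_sum F fun x _ => contDiff_const.mul (hb x)]
    simp only [lap_const_mul (hb _)]
    have hout : ∀ x : t, z ∉ Metric.closedBall (x : ℂ) (r x) →
        r x ^ 2 * lap φ x / 32 * lap (b x) z ≤ 0 :=
      fun x hx => mul_nonpos_of_nonneg_of_nonpos (hκ x) (hbout x z hx)
    by_cases hz : ∃ x ∈ F, z ∈ Metric.closedBall (x : ℂ) (r x)
    · obtain ⟨x, hxF, hx⟩ := hz
      rw [← Finset.add_sum_erase F _ hxF]
      have h1 : ∑ y ∈ F.erase x, r y ^ 2 * lap φ y / 32 * lap (b y) z ≤ 0 := by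
        refine Finset.sum_nonpos fun y hy => hout y fun hzy => ?_
        have hne : (x : ℂ) ≠ y := fun h => (Finset.mem_erase.1 hy).1 (Subtype.ext h.symm)
        exact Set.disjoint_left.1 (hdisj x.2 y.2 hne) hx hzy
      have h2 : r x ^ 2 * lap φ x / 32 * lap (b x) z ≤ lap φ x / 4 := by
        have hrx := hr x x.2
        calc _ ≤ r x ^ 2 * lap φ x / 32 * (8 / r x ^ 2) :=
              mul_le_mul_of_nonneg_left (hbin x z hx) (hκ x)
          _ = lap φ x / 4 := by
            field_simp
            ring
      have h3 := ((htr x x.2).1 z hx).1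
      linarith
    · push Not at hz
      have := hsub z
      exact (Finset.sum_nonpos fun x hx => hout x (hz x hx)).trans (by positivity)
  · have hlog : 0 ≤ Real.log (1 + ‖z‖ ^ 2) := Real.log_nonneg (by nlinarith [sq_nonneg ‖z‖])
    calc K * Real.log (1 + ‖z‖ ^ 2) - ∑ x ∈ F, r x ^ 2 * lap φ x / 32 * Cb x
        ≤ (∑ x ∈ F, r x ^ 2 * lap φ x / 32) * Real.log (1 + ‖z‖ ^ 2)
          - ∑ x ∈ F, r x ^ 2 * lap φ x / 32 * Cb x := by gcongr
      _ = ∑ x ∈ F, r x ^ 2 * lap φ x / 32 * (Real.log (1 + ‖z‖ ^ 2) - Cb x) := by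
          rw [Finset.sum_mul, ← Finset.sum_sub_distrib]
          exact Finset.sum_congr rfl fun x _ => by ring
      _ ≤ ∑ x ∈ F, r x ^ 2 * lap φ x / 32 * b x z :=
          Finset.sum_le_sum fun x _ => mul_le_mul_of_nonneg_left (hCb x z) (hκ x)

theorem lap_log_normSq_sub_add_nonneg (a : ℂ) {ε : ℝ} (hε : 0 < ε) (z : ℂ) :
    0 ≤ lap (fun w => Real.log (Complex.normSq (w - a) + ε)) z := by
  have h := lap_radial (H := fun t => Real.log (t + ε)) (H₁ := fun t => (t + ε)⁻¹)
    (H₂ := fun t => -1 / (t + ε) ^ 2)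
    (fun t ht => by simpa using ((hasDerivAt_id t).add_const ε).log (by simp only [id]; positivity))
    (fun t ht => ((hasDerivAt_id t).add_const ε).inv (by simp only [id]; positivity)) a z
  have ht := Complex.normSq_nonneg (z - a)
  have h' : 4 * (Complex.normSq (z - a) * (-1 / (Complex.normSq (z - a) + ε) ^ 2)
      + (Complex.normSq (z - a) + ε)⁻¹) = 4 * ε / (Complex.normSq (z - a) + ε) ^ 2 := by
    field_simp
    ring
  rw [h, h']
  positivity

theorem contDiff_log_normSq_sub_add (a : ℂ) {ε : ℝ} (hε : 0 < ε) :
    ContDiff ℝ 2 fun w : ℂ => Real.log (Complex.normSq (w - a) + ε) := by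
  simp only [Complex.normSq_eq_norm_sq]
  exact (((contDiff_id.sub contDiff_const).norm_sq ℝ).add contDiff_const).log fun w => by positivity

theorem exists_entire_integrable_mul_pow {φ : ℂ → ℝ} (hφ : ContDiff ℝ 2 φ)
    (hsub : ∀ z, 0 ≤ lap φ z)
    (htop : (volume.withDensity fun z => ENNReal.ofReal (lap φ z)) Set.univ = ⊤) (K : ℕ) :
    ∃ F : ℂ → ℂ, Differentiable ℂ F ∧ F ≠ 0 ∧
      Integrable fun z => ‖F z‖ ^ 2 * (1 + ‖z‖ ^ 2) ^ K * Real.exp (-φ z) := by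
  have hcont := hφ.continuous_lap
  obtain ⟨η, hη, hηlap, C₀, hC₀⟩ := exists_log_minorant hφ hsub htop (K + 2)
  obtain ⟨z₀, hz₀⟩ : ∃ z₀, 0 < lap φ z₀ := by
    by_contra! h
    simp [fun z => ENNReal.ofReal_of_nonpos (h z)] at htop
  obtain ⟨R, hR, hball⟩ := Metric.nhds_basis_closedBall.mem_iff.1
    (hcont.continuousAt.preimage_mem_nhds (Ici_mem_nhds (half_lt_self hz₀)))
  set ρ := R / 2
  have hρ : 0 < ρ := by positivity
  let χ : ContDiffBump z₀ := ⟨ρ, R, hρ, half_lt_self hR⟩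
  have hχ : ContDiff ℝ 2 χ := χ.contDiff
  have hχc : HasCompactSupport χ := χ.hasCompactSupport
  have hχann : ∀ z, fderiv ℝ χ z ≠ 0 → z ∈ Metric.closedBall z₀ R ∧ ρ ≤ ‖z - z₀‖ := by
    intro z hz
    constructor
    · have : z ∈ tsupport χ := support_fderiv_subset ℝ hz
      rwa [χ.tsupport_eq] at this
    · by_contra! hlt
      apply hz
      have : (χ : ℂ → ℝ) =ᶠ[nhds z] fun _ => 1 := by
        filter_upwards [Metric.isOpen_ball.mem_nhds (show z ∈ Metric.ball z₀ ρ by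
          rwa [Metric.mem_ball, dist_eq_norm])] with w hw
        exact χ.one_of_mem_closedBall (Metric.ball_subset_closedBall hw)
      rw [this.fderiv_eq]
      simp
  set N : ℂ → ℝ := fun z => ‖(pdxR χ z : ℂ) + Complex.I * (pdyR χ z : ℂ)‖ ^ 2 with hN
  have hdχ : Continuous (fderiv ℝ χ) := hχ.continuous_fderiv two_ne_zero
  have hNcont : Continuous N := by
    simp only [hN, pdxR, pdyR]
    fun_prop
  have hNz : ∀ z, fderiv ℝ χ z = 0 → N z = 0 := by
    intro z hz
    simp [hN, pdxR, pdyR, hz]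
  have hNc : HasCompactSupport N := by
    refine HasCompactSupport.intro hχc.isCompact fun z hz => hNz z ?_
    by_contra h
    exact hz (support_fderiv_subset ℝ h)
  have hηc := hη.continuous
  have hφc := hφ.continuous
  set A := ∫ z, N z * (Real.exp (η z - φ z) / ρ ^ 4)
  obtain ⟨x₀, -, hx₀⟩ := (isCompact_closedBall z₀ ρ).exists_isMinOn ⟨z₀, by simp [hρ.le]⟩
    (Continuous.continuousOn (f := fun z => Real.exp (η z - φ z)) (by fun_prop))
  set m := Real.exp (η x₀ - φ x₀)
  have hm0 : 0 < m := Real.exp_pos _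
  have hmle : ∀ z ∈ Metric.closedBall z₀ ρ, m ≤ Real.exp (η z - φ z) := fun z hz => hx₀ hz
  set c := lap φ z₀ / 4 with hc
  have hc0 : 0 < c := by positivity
  obtain ⟨n, hn⟩ := exists_nat_gt (A * (4 * ρ ^ 2 / (c * m * Real.pi)))
  set δ := ρ / (n + 1) with hδ
  have hδ0 : 0 < δ := by positivity
  have hδρ : δ ≤ ρ := div_le_self hρ.le (by linarith [Nat.cast_nonneg (α := ℝ) n])
  have hlarge : A < c * (m * Real.pi / (4 * δ ^ 2)) := by
    have hπ := Real.pi_pos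
    have h1 : A < n * (c * m * Real.pi) / (4 * ρ ^ 2) := by
      rw [lt_div_iff₀ (by positivity)]
      rw [← mul_div_assoc, div_lt_iff₀ (by positivity)] at hn
      exact hn
    have h2 : c * (m * Real.pi / (4 * δ ^ 2)) = (n + 1) ^ 2 * (c * m * Real.pi) / (4 * ρ ^ 2) := by
      rw [hδ]
      field_simp
    rw [h2]
    refine h1.trans_le ?_
    gcongr
    nlinarith [Nat.cast_nonneg (α := ℝ) n]
  have hδ2 : 0 < δ ^ 2 := by positivity
  have hlog := contDiff_log_normSq_sub_add z₀ hδ2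
  set ψ : ℂ → ℝ := fun z =>
    (φ z + (-1) * η z) + 2 * Real.log (Complex.normSq (z - z₀) + δ ^ 2) with hψdef
  have hψ : ContDiff ℝ 2 ψ := (hφ.add (contDiff_const.mul hη)).add (contDiff_const.mul hlog)
  have hψc := hψ.continuous
  have hψlap : ∀ z, lap φ z / 2 ≤ lap ψ z := by
    intro z
    rw [hψdef, lap_add (hφ.add (contDiff_const.mul hη)) (contDiff_const.mul hlog),
      lap_add hφ (contDiff_const.mul hη), lap_const_mul hη, lap_const_mul hlog]
    have h1 := hηlap z
    have h2 := lap_log_normSq_sub_add_nonneg z₀ hδ2 z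
    linarith
  have hexp : ∀ z, Real.exp (-ψ z) = Real.exp (η z - φ z) / (‖z - z₀‖ ^ 2 + δ ^ 2) ^ 2 := by
    intro z
    have hpos : 0 < ‖z - z₀‖ ^ 2 + δ ^ 2 := by positivity
    simp only [hψdef, Complex.normSq_eq_norm_sq]
    rw [show -((φ z + (-1) * η z) + 2 * Real.log (‖z - z₀‖ ^ 2 + δ ^ 2))
        = (η z - φ z) - (2 : ℕ) * Real.log (‖z - z₀‖ ^ 2 + δ ^ 2) by push_cast; ring,
      Real.exp_sub, ← Real.log_pow, Real.exp_log (by positivity)]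
  have hup : ∫ z, N z * Real.exp (-ψ z) ≤ A := by
    refine integral_mono (Continuous.integrable_of_hasCompactSupport (by fun_prop) hNc.mul_right)
      (Continuous.integrable_of_hasCompactSupport (by fun_prop) hNc.mul_right) fun z => ?_
    by_cases hz : fderiv ℝ χ z = 0
    · simp [hNz z hz]
    · have h1 : ρ ^ 2 ≤ ‖z - z₀‖ ^ 2 := pow_le_pow_left₀ hρ.le (hχann z hz).2 2
      have h2 : ρ ^ 4 ≤ (‖z - z₀‖ ^ 2 + δ ^ 2) ^ 2 := by
        rw [show ρ ^ 4 = (ρ ^ 2) ^ 2 by ring]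
        exact pow_le_pow_left₀ (by positivity) (by linarith) 2
      simp only [hexp]
      gcongr
  have hlow : m * Real.pi / (4 * δ ^ 2) ≤ ∫ z, χ z ^ 2 * Real.exp (-ψ z) := by
    have hInt : Integrable fun z => χ z ^ 2 * Real.exp (-ψ z) := by
      refine Continuous.integrable_of_hasCompactSupport
        ((hχ.continuous.pow 2).mul (by fun_prop)) ?_
      exact HasCompactSupport.intro hχc.isCompact fun z hz => by
        simp [image_eq_zero_of_notMem_tsupport hz]
    have hvol : volume.real (Metric.ball z₀ δ) = Real.pi * δ ^ 2 := by
      rw [Measure.real, Complex.volume_ball, ENNReal.toReal_mul, ENNReal.toReal_pow,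
        ENNReal.toReal_ofReal hδ0.le]
      simp [mul_comm]
    calc m * Real.pi / (4 * δ ^ 2) = ∫ z in Metric.ball z₀ δ, m / (2 * δ ^ 2) ^ 2 := by
          rw [setIntegral_const, hvol, smul_eq_mul]
          field_simp
          norm_num
      _ ≤ ∫ z in Metric.ball z₀ δ, χ z ^ 2 * Real.exp (-ψ z) := by
          refine setIntegral_mono_on (integrableOn_const (by finiteness)) hInt.integrableOn
            measurableSet_ball fun z hz => ?_
          have hzρ : z ∈ Metric.closedBall z₀ ρ :=
            Metric.closedBall_subset_closedBall hδρ (Metric.ball_subset_closedBall hz)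
          have h1 : ‖z - z₀‖ ^ 2 ≤ δ ^ 2 := by
            rw [← dist_eq_norm]
            exact pow_le_pow_left₀ dist_nonneg (Metric.mem_ball.1 hz).le 2
          rw [hexp, χ.one_of_mem_closedBall hzρ, one_pow, one_mul]
          gcongr
          · exact hmle z hzρ
          · linarith
      _ ≤ ∫ z, χ z ^ 2 * Real.exp (-ψ z) :=
          setIntegral_le_integral hInt (Filter.Eventually.of_forall fun z => by positivity)
  obtain ⟨F, hFd, hF0, hFi⟩ := exists_entire_of_integral_lt hψ
    (fun z => le_trans (by have := hsub z; positivity) (hψlap z)) hχ hχc hc0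
    (fun z hz => by
      have h1 : lap φ z₀ / 2 ≤ lap φ z := hball (hχann z hz).1
      have h2 := hψlap z
      linarith)
    (hup.trans_lt (hlarge.trans_le (mul_le_mul_of_nonneg_left hlow hc0.le)))
  refine ⟨F, hFd, hF0, ?_⟩
  set B := 2 * ‖z₀‖ ^ 2 + 2 + ρ ^ 2 with hB
  have hB0 : 0 < B := by positivity
  refine (hFi.const_mul (Real.exp (C₀ + 2 * Real.log B))).mono'
    (Continuous.aestronglyMeasurable (by have := hFd.continuous; fun_prop))
    (Filter.Eventually.of_forall fun z => ?_)
  have hz1 : 0 < 1 + ‖z‖ ^ 2 := by positivity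
  have hψle : ψ z ≤ φ z - K * Real.log (1 + ‖z‖ ^ 2) + (C₀ + 2 * Real.log B) := by
    have h1 : Real.log (Complex.normSq (z - z₀) + δ ^ 2) ≤ Real.log B + Real.log (1 + ‖z‖ ^ 2) := by
      rw [← Real.log_mul hB0.ne' hz1.ne', Complex.normSq_eq_norm_sq]
      apply Real.log_le_log (by positivity)
      have h2 : ‖z - z₀‖ ≤ ‖z‖ + ‖z₀‖ := norm_sub_le z z₀
      have h3 : ‖z - z₀‖ ^ 2 ≤ 2 * ‖z‖ ^ 2 + 2 * ‖z₀‖ ^ 2 := by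
        have := pow_le_pow_left₀ (norm_nonneg _) h2 2
        nlinarith [sq_nonneg (‖z‖ - ‖z₀‖)]
      have h4 : δ ^ 2 ≤ ρ ^ 2 := pow_le_pow_left₀ hδ0.le hδρ 2
      have h5 : 0 ≤ (2 * ‖z₀‖ ^ 2 + ρ ^ 2) * ‖z‖ ^ 2 := by positivity
      rw [hB]
      linarith
    have h2 := hC₀ z
    simp only [hψdef]
    linarith
  rw [Real.norm_of_nonneg (by positivity)]
  calc ‖F z‖ ^ 2 * (1 + ‖z‖ ^ 2) ^ K * Real.exp (-φ z)
      = ‖F z‖ ^ 2 * Real.exp (K * Real.log (1 + ‖z‖ ^ 2) - φ z) := by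
        rw [sub_eq_add_neg, Real.exp_add, ← Real.log_pow, Real.exp_log (by positivity)]
        ring
    _ ≤ ‖F z‖ ^ 2 * Real.exp ((C₀ + 2 * Real.log B) + -ψ z) := by
        gcongr
        linarith
    _ = Real.exp (C₀ + 2 * Real.log B) * (‖F z‖ ^ 2 * Real.exp (-ψ z)) := by
        rw [Real.exp_add]
        ring

/-- The weighted Fock space of entire functions `f` with `∫ |f|² exp (-φ) < ∞`. -/
def weightedFock (φ : ℂ → ℝ) (hφ : Continuous φ) : Submodule ℂ (ℂ → ℂ) where
  carrier := {f | Differentiable ℂ f ∧ Integrable fun z => ‖f z‖ ^ 2 * Real.exp (-φ z)}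
  zero_mem' := ⟨differentiable_const 0, by simp⟩
  add_mem' := by
    rintro f g ⟨hf, hfi⟩ ⟨hg, hgi⟩
    refine ⟨hf.add hg, ((hfi.const_mul 2).add (hgi.const_mul 2)).mono'
      (((hf.continuous.add hg.continuous).norm.pow 2).mul
        (Real.continuous_exp.comp hφ.neg)).aestronglyMeasurable
      (Filter.Eventually.of_forall fun z => ?_)⟩
    have h1 : ‖f z + g z‖ ^ 2 ≤ 2 * ‖f z‖ ^ 2 + 2 * ‖g z‖ ^ 2 := by
      have := pow_le_pow_left₀ (norm_nonneg _) (norm_add_le (f z) (g z)) 2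
      nlinarith [sq_nonneg (‖f z‖ - ‖g z‖)]
    have h2 := mul_le_mul_of_nonneg_right h1 (Real.exp_pos (-φ z)).le
    rw [Real.norm_of_nonneg (by positivity)]
    simp only [Pi.add_apply]
    linarith
  smul_mem' := by
    rintro c f ⟨hf, hfi⟩
    refine ⟨hf.const_smul c, (hfi.const_mul (‖c‖ ^ 2)).congr
      (Filter.Eventually.of_forall fun z => ?_)⟩
    simp only [Pi.smul_apply, smul_eq_mul, norm_mul]
    ring

theorem linearIndependent_mul_pow {F : ℂ → ℂ} (hF : Continuous F) (hF0 : F ≠ 0) :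
    LinearIndependent ℂ fun (j : ℕ) (z : ℂ) => F z * z ^ j := by
  let T : Polynomial ℂ →ₗ[ℂ] (ℂ → ℂ) :=
    LinearMap.mulLeft ℂ F ∘ₗ LinearMap.pi fun z => Polynomial.leval z
  have hT : LinearMap.ker T = ⊥ := by
    rw [LinearMap.ker_eq_bot']
    intro p hp
    obtain ⟨a, ha⟩ := Function.ne_iff.1 hF0
    refine p.eq_zero_of_infinite_isRoot
      ((infinite_of_mem_nhds a (hF.continuousAt.eventually_ne ha)).mono fun z hz => ?_)
    have h : F z * p.eval z = 0 := congrFun hp z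
    exact (mul_eq_zero.1 h).resolve_left hz
  have heq : (fun (j : ℕ) (z : ℂ) => F z * z ^ j) = T ∘ Polynomial.basisMonomials ℂ := by
    funext j z
    simp [T]
  rw [heq]
  exact (Polynomial.basisMonomials ℂ).linearIndependent.map' T hT

theorem not_finite_weightedFock {φ : ℂ → ℝ} (hφ : ContDiff ℝ 2 φ) (hsub : ∀ z, 0 ≤ lap φ z)
    (htop : (volume.withDensity fun z => ENNReal.ofReal (lap φ z)) Set.univ = ⊤) :
    ¬ Module.Finite ℂ (weightedFock φ hφ.continuous) := by
  intro hfin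
  set n := Module.finrank ℂ (weightedFock φ hφ.continuous) with hn
  have hφc := hφ.continuous
  obtain ⟨F, hF, hF0, hFi⟩ := exists_entire_integrable_mul_pow hφ hsub htop n
  have hmem : ∀ j : Fin (n + 1), (fun z => F z * z ^ (j : ℕ)) ∈ weightedFock φ hφ.continuous := by
    intro j
    refine ⟨hF.mul (differentiable_id.pow _), hFi.mono' (Continuous.aestronglyMeasurable (by
      have := hF.continuous
      fun_prop)) (Filter.Eventually.of_forall fun z => ?_)⟩
    rw [Real.norm_of_nonneg (by positivity), norm_mul, mul_pow, norm_pow, ← pow_mul, mul_comm _ 2,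
      pow_mul]
    have h1 : (‖z‖ ^ 2) ^ (j : ℕ) ≤ (1 + ‖z‖ ^ 2) ^ n :=
      (pow_le_pow_left₀ (by positivity) (by linarith) _).trans
        (pow_le_pow_right₀ (by nlinarith [sq_nonneg ‖z‖]) (Nat.lt_succ_iff.1 j.2))
    gcongr
  have hli : LinearIndependent ℂ
      fun j : Fin (n + 1) => (⟨_, hmem j⟩ : weightedFock φ hφ.continuous) :=
    LinearIndependent.of_comp (Submodule.subtype _)
      ((linearIndependent_mul_pow hF.continuous hF0).comp _ Fin.val_injective)
  have := hli.fintype_card_le_finrank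
  rw [Fintype.card_fin, ← hn] at this
  omega

/-- Let `φ : ℂ → ℝ` be a nonnegative subharmonic `C²` function such that
`Δφ dλ` is a nontrivial doubling measure on `ℂ`. Then the space of `C²` functions
`g : ℂ → ℂ` with `∫ |g|² dλ < ∞` and `(-Δ_A - V)g = 0` pointwise (`V = ½Δφ`) is an
infinite-dimensional complex vector space: the Pauli operator `P₋` has an
infinite-dimensional space of zero modes in `L²(ℝ²)`. -/
theorem pauli_minus_zero_modes_infinite_dimensional
    (φ : ℂ → ℝ) (hφC2 : ContDiff ℝ 2 φ) (hφ0 : ∀ z, 0 ≤ φ z)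
    (hsub : ∀ z, 0 ≤ lap φ z)
    (μ : Measure ℂ)
    (hμdef : μ = volume.withDensity fun z => ENNReal.ofReal (lap φ z))
    (hμne : μ ≠ 0)
    (C : ℝ) (hC : 0 < C)
    (hdoubling : ∀ (z : ℂ) (r : ℝ), 0 < r →
      μ (Metric.ball z r) ≤ ENNReal.ofReal C * μ (Metric.ball z (r / 2))) :
    ∃ g : ℕ → ℂ → ℂ,
      (∀ k, ContDiff ℝ 2 (g k) ∧
        Integrable (fun z => ‖g k z‖ ^ 2) ∧
        ∀ z, -(lapA φ (g k) z) - (((1 / 2) * lap φ z : ℝ) : ℂ) * g k z = 0) ∧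
      LinearIndependent ℂ g := by
  have htop := measure_univ_eq_top_of_doubling hμne hdoubling
  rw [hμdef] at htop
  let b := Module.Free.chooseBasis ℂ (weightedFock φ hφC2.continuous)
  have hinf : Infinite (Module.Free.ChooseBasisIndex ℂ (weightedFock φ hφC2.continuous)) := by
    by_contra h
    rw [not_infinite_iff_finite] at h
    exact not_finite_weightedFock hφC2 hsub htop (Module.Finite.of_basis b)
  let e := Infinite.natEmbedding (Module.Free.ChooseBasisIndex ℂ (weightedFock φ hφC2.continuous))
  refine ⟨fun k z => (Real.exp (-φ z / 2) : ℂ) * (b (e k) : ℂ → ℂ) z, fun k => ?_, ?_⟩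
  · obtain ⟨hd, hi⟩ := (b (e k)).2
    obtain ⟨h1, h2⟩ := pauli_zero_mode_of_entire hφC2 hd
    refine ⟨h1, hi.congr (Filter.Eventually.of_forall fun z => ?_), h2⟩
    have hexp : Real.exp (-φ z / 2) ^ 2 = Real.exp (-φ z) := by
      rw [← Real.exp_nat_mul]
      congr 1
      push_cast
      ring
    simp only [norm_mul, mul_pow, Complex.norm_real, Real.norm_of_nonneg (Real.exp_pos _).le, hexp]
    ring
  · refine ((b.linearIndependent.comp e e.injective).map' (Submodule.subtype _)
      (Submodule.ker_subtype _)).map'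
      (LinearMap.mulLeft ℂ fun z => (Real.exp (-φ z / 2) : ℂ)) ?_
    rw [LinearMap.ker_eq_bot']
    intro f hf
    funext z
    have h : (Real.exp (-φ z / 2) : ℂ) * f z = 0 := congrFun hf z
    exact (mul_eq_zero.1 h).resolve_left (by exact_mod_cast (Real.exp_pos _).ne')
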